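/- arXiv:1503.06989 — 6 statements merged into one kernel-verified Lean document; each statement's English description precedes it below -/
import Mathlib

section
/- Let (Ω,F,P) be a probability space with a filtration (F_t)_{t∈ℕ}, D a measurable space, (ω_t)_{t∈ℕ} an adapted D-valued process, g : D → ℝ measurable, X_t = g(ω_t), and B ⊆ D measurable. Assume there are constants A1, A2, a1 > 0 such that: |g(x)| ≤ A1 for all x ∈ D; |X_t − X_{t−1}| ≤ A2 almost surely for all t ≥ 1; and E[X_t − X_{t−1} | F_{t−1}] ≥ a1·1{ω_{t−1} ∉ B} almost surely for all t ≥ 1. Let τ = inf{t ≥ 0 : ω_t ∈ B}. If a2 > 0 and X_0 ≥ A1 − a2 almost surely, then E[τ] ≤ a2/a1, and for every T ∈ ℕ with a2 − a1·T < 0 one has P(τ ≥ T) ≤ exp(−(a2 − a1·T)²/(4·A2²·T)). -/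
/- STATEMENT 4: A hitting-time estimate for adapted processes with bounded increments and
   a uniform positive drift off a set B: the hitting time of B has expectation at most
   a2/a1 and an Azuma-type tail bound. -/

open MeasureTheory
open scoped ENNReal NNReal

/-- The first hitting time of the set `B` by the process `ω`, valued in `ℝ≥0∞`
(`⊤` if the process never visits `B`). -/
noncomputable def hitTime {Ω D : Type*} (ω : ℕ → Ω → D) (B : Set D) (x : Ω) : ℝ≥0∞ :=
  ⨅ t ∈ {t : ℕ | ω t x ∈ B}, (t : ℝ≥0∞)

theorem le_hitTime_iff {Ω D : Type*} {ω : ℕ → Ω → D} {B : Set D} {x : Ω} {T : ℕ} :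
    (T : ℝ≥0∞) ≤ hitTime ω B x ↔ ∀ k < T, ω k x ∉ B := by
  simp only [hitTime, le_iInf_iff, Nat.cast_le, Set.mem_ofPred_eq]
  exact forall_congr' fun k =>
    ⟨fun h hk hB => (h hB).not_gt hk, fun h hB => not_lt.1 fun hk => h hk hB⟩

theorem hitTime_le_tsum_indicator {Ω D : Type*} (ω : ℕ → Ω → D) (B : Set D) (x : Ω) :
    hitTime ω B x ≤
      ∑' n : ℕ, {y | ∀ k < n + 1, ω k y ∉ B}.indicator (fun _ => (1 : ℝ≥0∞)) x := by
  classical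
  by_cases h : ∃ n, ω n x ∈ B
  · calc
      hitTime ω B x ≤ (Nat.find h : ℝ≥0∞) := iInf₂_le (Nat.find h) (Nat.find_spec h)
      _ = ∑ n ∈ Finset.range (Nat.find h),
          {y | ∀ k < n + 1, ω k y ∉ B}.indicator (fun _ => (1 : ℝ≥0∞)) x := by
        have hmem : ∀ n ∈ Finset.range (Nat.find h), x ∈ {y | ∀ k < n + 1, ω k y ∉ B} :=
          fun n hn k hk => Nat.find_min h
            ((Nat.le_of_lt_succ hk).trans_lt (Finset.mem_range.1 hn))
        rw [Finset.sum_congr rfl fun n hn => Set.indicator_of_mem (hmem n hn) _]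
        simp
      _ ≤ _ := ENNReal.sum_le_tsum _
  · push Not at h
    simp [h]

/-- A lower bound on a conditional expectation over a set survives integration against a
nonnegative bounded weight. -/
theorem mul_setIntegral_le_setIntegral_mul_of_le_condExp
    {Ω : Type*} {m m0 : MeasurableSpace Ω} {μ : Measure Ω} [IsFiniteMeasure μ] (hm : m ≤ m0)
    {C : Set Ω} (hC : MeasurableSet[m] C) {W f : Ω → ℝ} (hW : StronglyMeasurable[m] W)
    {K a : ℝ} (hW0 : ∀ x, 0 ≤ W x) (hWK : ∀ x, W x ≤ K) (hf : Integrable f μ)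
    (ha : ∀ᵐ x ∂μ, x ∈ C → a ≤ (μ[f|m]) x) :
    a * ∫ x in C, W x ∂μ ≤ ∫ x in C, W x * f x ∂μ := by
  have hnorm : ∀ᵐ x ∂μ, ‖W x‖ ≤ K := .of_forall fun x => by
    rw [Real.norm_of_nonneg (hW0 x)]; exact hWK x
  have hWm := (hW.mono hm).aestronglyMeasurable (μ := μ)
  have hWf : Integrable (W * f) μ := hf.bdd_mul hWm hnorm
  calc
    a * ∫ x in C, W x ∂μ = ∫ x in C, W x * a ∂μ := by
      rw [integral_mul_const, mul_comm]
    _ ≤ ∫ x in C, W x * (μ[f|m]) x ∂μ := by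
      refine setIntegral_mono_on_ae ((Integrable.of_bound hWm K hnorm).mul_const a).integrableOn
        (integrable_condExp.bdd_mul hWm hnorm).integrableOn (hm _ hC) ?_
      filter_upwards [ha] with x hx hxC
      exact mul_le_mul_of_nonneg_left (hx hxC) (hW0 x)
    _ = ∫ x in C, (μ[W * f|m]) x ∂μ := by
      refine integral_congr_ae (ae_restrict_of_ae ?_)
      filter_upwards [condExp_mul_of_stronglyMeasurable_left hW hWf hf] with x hx
      exact hx.symm
    _ = ∫ x in C, W x * f x ∂μ := setIntegral_condExp hm hWf hC

theorem exp_neg_le_one_sub_add_sq {x : ℝ} (hx : |x| ≤ 1) : Real.exp (-x) ≤ 1 - x + x ^ 2 := by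
  have h := (abs_le.1 (Real.abs_exp_sub_one_sub_id_le (x := -x) (by rwa [abs_neg]))).2
  linarith [neg_sq x]

theorem hitting_time_bound_of_drift
    {Ω : Type*} {m0 : MeasurableSpace Ω} (μ : Measure Ω) [IsProbabilityMeasure μ]
    {D : Type*} [MeasurableSpace D]
    (ℱ : Filtration ℕ m0)
    (ω : ℕ → Ω → D) (hadapted : ∀ t, Measurable[ℱ t] (ω t))
    (g : D → ℝ) (hg : Measurable g)
    (B : Set D) (hB : MeasurableSet B)
    (A1 A2 a1 : ℝ) (hA1 : 0 < A1) (hA2 : 0 < A2) (ha1 : 0 < a1)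
    (hbdd : ∀ x : D, |g x| ≤ A1)
    (hincr : ∀ t : ℕ, 1 ≤ t →
      ∀ᵐ x ∂μ, |g (ω t x) - g (ω (t - 1) x)| ≤ A2)
    (hdrift : ∀ t : ℕ, 1 ≤ t →
      ∀ᵐ x ∂μ, Set.indicator Bᶜ (fun _ => a1) (ω (t - 1) x)
        ≤ (μ[fun y => g (ω t y) - g (ω (t - 1) y)|ℱ (t - 1)]) x)
    (a2 : ℝ) (ha2 : 0 < a2)
    (hstart : ∀ᵐ x ∂μ, A1 - a2 ≤ g (ω 0 x)) :
    (∫⁻ x, hitTime ω B x ∂μ) ≤ ENNReal.ofReal (a2 / a1) ∧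
    ∀ T : ℕ, a2 - a1 * T < 0 →
      μ {x | (T : ℝ≥0∞) ≤ hitTime ω B x}
        ≤ ENNReal.ofReal (Real.exp (-(a2 - a1 * T) ^ 2 / (4 * A2 ^ 2 * T))) := by
  set X : ℕ → Ω → ℝ := fun n x => g (ω n x) with hX
  set C : ℕ → Set Ω := fun n => {x | ∀ k < n, ω k x ∉ B}
  have hC_succ (n : ℕ) : MeasurableSet[ℱ n] (C (n + 1)) := by
    have : C (n + 1) = ⋂ k ∈ Set.Iio (n + 1), (ω k ⁻¹' B)ᶜ := by ext; simp [C]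
    rw [this]
    exact MeasurableSet.biInter (Set.to_countable _) fun k hk =>
      (ℱ.mono (Nat.lt_succ_iff.1 hk) _ (hadapted k hB)).compl
  have hC_meas (n : ℕ) : MeasurableSet (C n) := by
    cases n with
    | zero => simp [C]
    | succ n => exact ℱ.le n _ (hC_succ n)
  have hC_zero : C 0 = Set.univ := by simp [C]
  have hC_anti (n : ℕ) : C (n + 1) ⊆ C n := fun x hx k hk => hx k (hk.trans n.lt_succ_self)
  have hXm (n : ℕ) : StronglyMeasurable[ℱ n] (X n) :=
    (hg.comp (hadapted n)).stronglyMeasurable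
  have hXle (n : ℕ) (x : Ω) : X n x ≤ A1 := (abs_le.1 (hbdd _)).2
  have hXge (n : ℕ) (x : Ω) : -A1 ≤ X n x := (abs_le.1 (hbdd _)).1
  have hXint (n : ℕ) : Integrable (X n) μ :=
    .of_bound ((hXm n).mono (ℱ.le n)).aestronglyMeasurable A1 (.of_forall fun _ => hbdd _)
  have hΔint (n : ℕ) : Integrable (fun x => X (n + 1) x - X n x) μ := (hXint _).sub (hXint n)
  have hΔ (n : ℕ) : ∀ᵐ x ∂μ, |X (n + 1) x - X n x| ≤ A2 := hincr (n + 1) (by simp)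
  have hcond (n : ℕ) : ∀ᵐ x ∂μ, x ∈ C (n + 1) →
      a1 ≤ (μ[fun y => X (n + 1) y - X n y|ℱ n]) x := by
    filter_upwards [hdrift (n + 1) (by simp)] with x hx hxC
    have hxB : ω n x ∈ Bᶜ := hxC n n.lt_succ_self
    simpa [hxB] using hx
  have hweight (n : ℕ) {W : Ω → ℝ} {K : ℝ} (hW : StronglyMeasurable[ℱ n] W)
      (hW0 : ∀ x, 0 ≤ W x) (hWK : ∀ x, W x ≤ K) :=
    mul_setIntegral_le_setIntegral_mul_of_le_condExp (ℱ.le n) (hC_succ n) hW hW0 hWK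
      (hΔint n) (hcond n)
  have hmass (n : ℕ) :
      a1 * μ.real (C (n + 1)) ≤ ∫ x in C (n + 1), (X (n + 1) x - X n x) ∂μ := by
    simpa using hweight n (W := fun _ => 1) (K := 1) stronglyMeasurable_const
      (fun _ => zero_le_one) (fun _ => le_rfl)
  constructor
  · have hgap (n : ℕ) : Integrable (fun x => A1 - X n x) μ := (integrable_const _).sub (hXint n)
    have hpot (n : ℕ) : (∫ x in C n, (A1 - X n x) ∂μ)
        + a1 * ∑ k ∈ Finset.range n, μ.real (C (k + 1)) ≤ a2 := by
      induction n with
      | zero =>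
        simp only [Finset.range_zero, Finset.sum_empty, mul_zero, add_zero, hC_zero,
          setIntegral_univ]
        calc
          ∫ x, (A1 - X 0 x) ∂μ ≤ ∫ _, a2 ∂μ := by
            refine integral_mono_ae (hgap 0) (integrable_const _) ?_
            filter_upwards [hstart] with x hx
            simp only [hX]; linarith
          _ = a2 := by simp
      | succ n ih =>
        have hstep : ∫ x in C (n + 1), (A1 - X (n + 1) x) ∂μ =
            (∫ x in C (n + 1), (A1 - X n x) ∂μ)
              - ∫ x in C (n + 1), (X (n + 1) x - X n x) ∂μ := by
          rw [← integral_sub (hgap n).integrableOn (hΔint n).integrableOn]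
          congr with x; ring
        have hsub : ∫ x in C (n + 1), (A1 - X n x) ∂μ ≤ ∫ x in C n, (A1 - X n x) ∂μ :=
          setIntegral_mono_set (hgap n).integrableOn
            (.of_forall fun x => sub_nonneg.2 (hXle n x)) (hC_anti n).eventuallyLE
        rw [Finset.sum_range_succ, mul_add]
        linarith [hmass n]
    calc
      ∫⁻ x, hitTime ω B x ∂μ
          ≤ ∫⁻ x, ∑' n : ℕ, (C (n + 1)).indicator (fun _ => (1 : ℝ≥0∞)) x ∂μ :=
        lintegral_mono fun x => hitTime_le_tsum_indicator ω B x
      _ = ∑' n : ℕ, μ (C (n + 1)) := by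
        rw [lintegral_tsum fun n => (measurable_const.indicator (hC_meas _)).aemeasurable]
        simp [lintegral_indicator, hC_meas]
      _ ≤ ENNReal.ofReal (a2 / a1) := by
        refine ENNReal.tsum_le_of_sum_range_le fun n => ?_
        have hsum : ∑ k ∈ Finset.range n, μ (C (k + 1)) =
            ENNReal.ofReal (∑ k ∈ Finset.range n, μ.real (C (k + 1))) := by
          rw [ENNReal.ofReal_sum_of_nonneg fun _ _ => measureReal_nonneg]
          simp
        rw [hsum]
        refine ENNReal.ofReal_le_ofReal ((le_div_iff₀' ha1).2 ?_)
        have : 0 ≤ ∫ x in C n, (A1 - X n x) ∂μ :=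
          integral_nonneg fun x => sub_nonneg.2 (hXle n x)
        linarith [hpot n]
  · intro T hT
    have hset : {x | (T : ℝ≥0∞) ≤ hitTime ω B x} = C T := by
      ext x; exact le_hitTime_iff
    rw [hset]
    have hT0 : 0 < T := by
      rcases Nat.eq_zero_or_pos T with rfl | h
      · simp at hT; linarith
      · exact h
    have hTpos : (0 : ℝ) < T := by exact_mod_cast hT0
    rcases lt_or_ge A2 a1 with hlt | hle
    · have hle_one : a1 * μ.real (C 1) ≤ A2 * μ.real (C 1) :=
        (hmass 0).trans <| calc
          ∫ x in C 1, (X 1 x - X 0 x) ∂μ ≤ ∫ _ in C 1, A2 ∂μ := by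
            refine setIntegral_mono_ae (hΔint 0).integrableOn (integrable_const _) ?_
            filter_upwards [hΔ 0] with x hx using (le_abs_self _).trans hx
          _ = A2 * μ.real (C 1) := by simp [mul_comm]
      have hreal : μ.real (C 1) = 0 :=
        le_antisymm (by nlinarith) measureReal_nonneg
      have hsub : C T ⊆ C 1 := fun x hx k hk => hx k (by omega)
      have hnull : μ (C T) = 0 := measure_mono_null hsub (((measureReal_eq_zero_iff).1 hreal))
      simp [hnull]
    set r : ℝ := (a1 * T - a2) / (2 * A2 ^ 2 * T) with hr
    have hr0 : 0 < r := div_pos (by linarith) (by positivity)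
    have hrA2 : r * A2 ≤ 1 := by
      have : r * A2 = (a1 * T - a2) / (2 * A2 * T) := by rw [hr]; field_simp
      rw [this, div_le_one (by positivity)]
      nlinarith [mul_pos hA2 hTpos]
    have hWm (n : ℕ) : StronglyMeasurable[ℱ n] fun x => Real.exp (-(r * X n x)) :=
      Real.continuous_exp.comp_stronglyMeasurable
        ((hXm n).const_mul r).neg
    have hWK (n : ℕ) (x : Ω) : Real.exp (-(r * X n x)) ≤ Real.exp (r * A1) :=
      Real.exp_le_exp.2 (by nlinarith [hXge n x])
    have hWint (n : ℕ) : Integrable (fun x => Real.exp (-(r * X n x))) μ :=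
      .of_bound ((hWm n).mono (ℱ.le n)).aestronglyMeasurable _
        (.of_forall fun x => by rw [Real.norm_of_nonneg (Real.exp_pos _).le]; exact hWK n x)
    have hWΔint (n : ℕ) :
        Integrable (fun x => Real.exp (-(r * X n x)) * (X (n + 1) x - X n x)) μ :=
      (hΔint n).bdd_mul ((hWm n).mono (ℱ.le n)).aestronglyMeasurable
        (.of_forall fun x => by rw [Real.norm_of_nonneg (Real.exp_pos _).le]; exact hWK n x)
    have hstep (n : ℕ) : ∫ x in C (n + 1), Real.exp (-(r * X (n + 1) x)) ∂μ ≤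
        Real.exp (-(r * a1) + r ^ 2 * A2 ^ 2) * ∫ x in C n, Real.exp (-(r * X n x)) ∂μ :=
      calc
        ∫ x in C (n + 1), Real.exp (-(r * X (n + 1) x)) ∂μ
            ≤ ∫ x in C (n + 1), ((1 + r ^ 2 * A2 ^ 2) * Real.exp (-(r * X n x))
              - r * (Real.exp (-(r * X n x)) * (X (n + 1) x - X n x))) ∂μ := by
          refine setIntegral_mono_ae (hWint _).integrableOn
            (((hWint n).const_mul _).sub ((hWΔint n).const_mul r)).integrableOn ?_
          filter_upwards [hΔ n] with x hx
          have habs : |r * (X (n + 1) x - X n x)| ≤ r * A2 := by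
            rw [abs_mul, abs_of_pos hr0]
            exact mul_le_mul_of_nonneg_left hx hr0.le
          have hsq : (r * (X (n + 1) x - X n x)) ^ 2 ≤ (r * A2) ^ 2 := sq_le_sq' (abs_le.1 habs).1
            (abs_le.1 habs).2
          have hexp := exp_neg_le_one_sub_add_sq (habs.trans hrA2)
          have hsplit : Real.exp (-(r * X (n + 1) x)) =
              Real.exp (-(r * X n x)) * Real.exp (-(r * (X (n + 1) x - X n x))) := by
            rw [← Real.exp_add]; congr 1; ring
          rw [hsplit]
          calc
            _ ≤ Real.exp (-(r * X n x)) *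
                (1 - r * (X (n + 1) x - X n x) + (r * A2) ^ 2) :=
              mul_le_mul_of_nonneg_left (by linarith) (Real.exp_pos _).le
            _ = _ := by ring
        _ = (1 + r ^ 2 * A2 ^ 2) * (∫ x in C (n + 1), Real.exp (-(r * X n x)) ∂μ)
            - r * ∫ x in C (n + 1), Real.exp (-(r * X n x)) * (X (n + 1) x - X n x) ∂μ := by
          rw [integral_sub ((hWint n).const_mul _).integrableOn
            ((hWΔint n).const_mul r).integrableOn, integral_const_mul, integral_const_mul]
        _ ≤ (1 + r ^ 2 * A2 ^ 2) * (∫ x in C (n + 1), Real.exp (-(r * X n x)) ∂μ)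
            - r * (a1 * ∫ x in C (n + 1), Real.exp (-(r * X n x)) ∂μ) := by
          gcongr
          exact hweight n (hWm n) (fun x => (Real.exp_pos _).le) (hWK n)
        _ = (-(r * a1) + r ^ 2 * A2 ^ 2 + 1) *
            ∫ x in C (n + 1), Real.exp (-(r * X n x)) ∂μ := by ring
        _ ≤ Real.exp (-(r * a1) + r ^ 2 * A2 ^ 2) *
            ∫ x in C (n + 1), Real.exp (-(r * X n x)) ∂μ :=
          mul_le_mul_of_nonneg_right (Real.add_one_le_exp _)
            (integral_nonneg fun x => (Real.exp_pos _).le)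
        _ ≤ _ := mul_le_mul_of_nonneg_left
          (setIntegral_mono_set (hWint n).integrableOn
            (.of_forall fun x => (Real.exp_pos _).le) (hC_anti n).eventuallyLE)
          (Real.exp_pos _).le
    have hiter (n : ℕ) : ∫ x in C n, Real.exp (-(r * X n x)) ∂μ ≤
        Real.exp (n * (-(r * a1) + r ^ 2 * A2 ^ 2) - r * (A1 - a2)) := by
      induction n with
      | zero =>
        rw [hC_zero, setIntegral_univ]
        calc
          ∫ x, Real.exp (-(r * X 0 x)) ∂μ ≤ ∫ _, Real.exp (-(r * (A1 - a2))) ∂μ := by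
            refine integral_mono_ae (hWint 0) (integrable_const _) ?_
            filter_upwards [hstart] with x hx
            exact Real.exp_le_exp.2 (neg_le_neg (mul_le_mul_of_nonneg_left hx hr0.le))
          _ = _ := by simp
      | succ n ih =>
        refine (hstep n).trans ((mul_le_mul_of_nonneg_left ih (Real.exp_pos _).le).trans_eq ?_)
        rw [← Real.exp_add]
        congr 1
        push_cast
        ring
    have hlower : Real.exp (-(r * A1)) * μ.real (C T) ≤
        ∫ x in C T, Real.exp (-(r * X T x)) ∂μ :=
      calc
        Real.exp (-(r * A1)) * μ.real (C T) = ∫ _ in C T, Real.exp (-(r * A1)) ∂μ := by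
          simp [mul_comm]
        _ ≤ _ := setIntegral_mono (integrable_const _) (hWint T).integrableOn fun x =>
          Real.exp_le_exp.2 (neg_le_neg (mul_le_mul_of_nonneg_left (hXle T x) hr0.le))
    have hfinal : μ.real (C T) ≤ Real.exp (-(a2 - a1 * T) ^ 2 / (4 * A2 ^ 2 * T)) := by
      refine le_of_mul_le_mul_left ((hlower.trans (hiter T)).trans_eq ?_)
        (Real.exp_pos (-(r * A1)))
      rw [← Real.exp_add]
      congr 1
      rw [hr]
      field_simp
      ring
    rw [← ofReal_measureReal]
    exact ENNReal.ofReal_le_ofReal hfinal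
end

section
/- Let (Ω,F,P) be a probability space with a filtration (F_t)_{t∈ℕ}, D a measurable space, (ω_t)_{t∈ℕ} an adapted D-valued process, g : D → ℝ measurable, X_t = g(ω_t). Assume constants A1, A2, a1 > 0 with |g| ≤ A1, |X_t − X_{t−1}| ≤ A2 a.s. for all t ≥ 1, and E[X_t − X_{t−1} | F_{t−1}] ≥ a1·1{ω_{t−1} ∉ B} a.s. for all t ≥ 1, where for some a4 > 2·A2 we set B = {x ∈ D : g(x) ≥ A1 − a4} and B' = {x ∈ D : g(x) ≤ A1 − 2·a4}. Suppose ω_0 ∈ B almost surely and let T be a time with T > 2·A2/a1. Set T' = exp(min(a4², a1²·T²)/(32·A2²·T)). Then P(τ(B') ≥ T') ≥ 1 − exp(−a4²/(32·A2²·T)) − exp(−a1²·T²/(32·A2²·T)), where τ(B') = inf{t ≥ 0 : ω_t ∈ B'}. -/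
/- STATEMENT 5: Under the same drift conditions, started in the super-level set
   B = {g ≥ A1 − a4}, the process takes at least T' = exp(min(a4², a1²T²)/(32A2²T))
   steps to reach the sub-level set B' = {g ≤ A1 − 2a4}, with high probability. -/

open MeasureTheory
open scoped ENNReal NNReal

/-- The function `s ↦ cosh s - s * sinh s` is at most `1` on the nonnegative reals. -/
theorem cosh_sub_mul_sinh_le_one {s : ℝ} (hs : 0 ≤ s) :
    Real.cosh s - s * Real.sinh s ≤ 1 := by
  have hmul : Real.exp s * Real.exp (-s) = 1 := by rw [← Real.exp_add]; simp
  have h1 : 1 - s ≤ Real.exp (-s) := by linarith [Real.add_one_le_exp (-s)]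
  have h2 : 1 ≤ Real.exp s := Real.one_le_exp hs
  have h3 : 0 < Real.exp (-s) := Real.exp_pos _
  rw [Real.cosh_eq, Real.sinh_eq]
  set a := Real.exp s
  set b := Real.exp (-s)
  have h4 : a - 1 ≤ s * a := by nlinarith
  have hb : b ≤ 1 := by nlinarith
  have h5 : (a - 1) * (1 - b) ≤ s * a * (1 - b) :=
    mul_le_mul_of_nonneg_right h4 (by linarith)
  nlinarith [mul_nonneg hs (sub_nonneg.2 hb)]

/-- One step of a process `X, Y` whose increment is bounded by `A` and has conditional drift at
least `a` on the set `s`, while `X ≥ L` off `s`: the exponential moment of `L - Y` exceeds that of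
`L - X` by at most `exp (a / A)`. -/
theorem integral_exp_le_of_drift {Ω : Type*} {m m0 : MeasurableSpace Ω} {μ : Measure Ω}
    [IsProbabilityMeasure μ] (hm : m ≤ m0) {X Y : Ω → ℝ} {C A a L : ℝ} {s : Set Ω}
    (hX : Measurable[m] X) (hY : Measurable[m0] Y) (hXC : ∀ x, |X x| ≤ C) (hYC : ∀ x, |Y x| ≤ C)
    (hA : 0 < A) (ha : 0 < a) (hs : MeasurableSet[m] s)
    (hincr : ∀ᵐ x ∂μ, |Y x - X x| ≤ A)
    (hdrift : ∀ᵐ x ∂μ, x ∈ s → a ≤ (μ[fun y => Y y - X y|m]) x)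
    (hL : ∀ x ∉ s, L ≤ X x) :
    ∫ x, Real.exp (a / A ^ 2 * (L - Y x)) ∂μ
      ≤ ∫ x, Real.exp (a / A ^ 2 * (L - X x)) ∂μ + Real.exp (a / A) := by
  have hX0 : Measurable[m0] X := hX.mono hm le_rfl
  set θ := a / A ^ 2 with hθdef
  have hθ : 0 < θ := by positivity
  have hθA : θ * A = a / A := by rw [hθdef]; field_simp
  have hexp : ∀ Z : Ω → ℝ, Measurable[m0] Z → (∀ x, |Z x| ≤ C) →
      Integrable (fun x => Real.exp (θ * (L - Z x))) μ := by
    intro Z hZ hZC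
    refine Integrable.of_bound (by fun_prop) (Real.exp (θ * (L + C))) (ae_of_all _ fun x => ?_)
    rw [Real.norm_eq_abs, Real.abs_exp]
    have := (abs_le.1 (hZC x)).1
    gcongr
    linarith
  have hVX := hexp X hX0 hXC
  have hVY := hexp Y hY hYC
  have hΔ : Integrable (fun x => Y x - X x) μ :=
    (Integrable.of_bound hY.aestronglyMeasurable C (ae_of_all _ hYC)).sub
      (Integrable.of_bound hX0.aestronglyMeasurable C (ae_of_all _ hXC))
  set W : Ω → ℝ := s.indicator fun x => Real.exp (θ * (L - X x)) with hW
  have hWm : Measurable[m] W := by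
    refine Measurable.indicator ?_ hs
    exact Real.measurable_exp.comp ((measurable_const.sub hX).const_mul θ)
  have hWi : Integrable W μ := hVX.indicator (hm _ hs)
  have hW0 : ∀ x, 0 ≤ W x := fun x => Set.indicator_nonneg (fun _ _ => (Real.exp_pos _).le) x
  have hWΔ : Integrable (fun x => W x * (Y x - X x)) μ := by
    refine hWi.mul_bdd (c := A) hΔ.aestronglyMeasurable ?_
    filter_upwards [hincr] with x hx using hx
  have hcond : a * ∫ x, W x ∂μ ≤ ∫ x, W x * (Y x - X x) ∂μ := by
    have hpull := condExp_mul_of_stronglyMeasurable_left (μ := μ) hWm.stronglyMeasurable hWΔ hΔ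
    calc a * ∫ x, W x ∂μ = ∫ x, a * W x ∂μ := (integral_const_mul _ _).symm
      _ ≤ ∫ x, (μ[fun x => W x * (Y x - X x)|m]) x ∂μ := by
        refine integral_mono_ae (hWi.const_mul a) integrable_condExp ?_
        filter_upwards [hpull, hdrift] with x hx hd
        refine le_of_le_of_eq ?_ hx.symm
        by_cases hxs : x ∈ s
        · simpa [mul_comm] using mul_le_mul_of_nonneg_left (hd hxs) (hW0 x)
        · simp [hW, hxs]
      _ = _ := integral_condExp hm
  have hpt : ∀ᵐ x ∂μ, Real.exp (θ * (L - Y x)) ≤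
      (Real.cosh (a / A) * W x - Real.sinh (a / A) / A * (W x * (Y x - X x)))
        + Real.exp (a / A) := by
    filter_upwards [hincr] with x hx
    by_cases hxs : x ∈ s
    · have ht : |(X x - Y x) / A| ≤ 1 := by
        rw [abs_div, abs_of_pos hA, div_le_one hA, abs_sub_comm]; exact hx
      have h1 := Real.exp_mul_le_cosh_add_mul_sinh ht (a / A)
      have h2 : Real.exp (θ * (L - Y x))
          = Real.exp (θ * (L - X x)) * Real.exp ((X x - Y x) / A * (a / A)) := by
        rw [← Real.exp_add]; congr 1; rw [hθdef]; field_simp; ring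
      have h3 := mul_le_mul_of_nonneg_left h1 (Real.exp_pos (θ * (L - X x))).le
      have h4 := Real.exp_pos (a / A)
      have h5 : W x = Real.exp (θ * (L - X x)) := by simp [hW, hxs]
      rw [h2, h5]
      refine h3.trans (le_of_eq_of_le ?_ (le_add_of_nonneg_right h4.le))
      field_simp
      ring
    · have h1 : W x = 0 := by simp [hW, hxs]
      have h2 := hL x hxs
      have h3 := (abs_le.1 hx).1
      rw [h1, ← hθA]
      simp only [mul_zero, zero_mul, sub_zero, zero_add]
      gcongr
      linarith
  have h_integrable : Integrable (fun x => Real.cosh (a / A) * W x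
      - Real.sinh (a / A) / A * (W x * (Y x - X x))) μ :=
    (hWi.const_mul _).sub (hWΔ.const_mul _)
  have hsinh : 0 ≤ Real.sinh (a / A) / A :=
    div_nonneg (Real.sinh_nonneg_iff.2 (by positivity)) hA.le
  have hWint : 0 ≤ ∫ x, W x ∂μ := integral_nonneg hW0
  have hWle : ∫ x, W x ∂μ ≤ ∫ x, Real.exp (θ * (L - X x)) ∂μ :=
    integral_mono hWi hVX fun x =>
      Set.indicator_le_self' (fun _ _ => (Real.exp_pos _).le) x
  calc ∫ x, Real.exp (θ * (L - Y x)) ∂μ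
      ≤ ∫ x, (Real.cosh (a / A) * W x - Real.sinh (a / A) / A * (W x * (Y x - X x)))
        + Real.exp (a / A) ∂μ := integral_mono_ae hVY (h_integrable.add (integrable_const _)) hpt
    _ = Real.cosh (a / A) * ∫ x, W x ∂μ
        - Real.sinh (a / A) / A * ∫ x, W x * (Y x - X x) ∂μ + Real.exp (a / A) := by
      rw [integral_add h_integrable (integrable_const _),
        integral_sub (hWi.const_mul _) (hWΔ.const_mul _), integral_const_mul, integral_const_mul]
      simp
    _ ≤ (Real.cosh (a / A) - a / A * Real.sinh (a / A)) * ∫ x, W x ∂μ + Real.exp (a / A) := by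
      have := mul_le_mul_of_nonneg_left hcond hsinh
      have h : Real.sinh (a / A) / A * (a * ∫ x, W x ∂μ)
        = a / A * Real.sinh (a / A) * ∫ x, W x ∂μ := by ring
      linarith
    _ ≤ ∫ x, Real.exp (θ * (L - X x)) ∂μ + Real.exp (a / A) := by
      have := mul_le_mul_of_nonneg_right
        (cosh_sub_mul_sinh_le_one (s := a / A) (by positivity)) hWint
      linarith

/-- A process with drift at least `a` below the level `L` and increments bounded by
`A`, started above `L`, is at most `L - r` at time `t` with probability at most
`(t + 1) * exp (a / A ^ 2 * (A - r))`. -/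
theorem measureReal_le_of_drift {Ω : Type*} {m0 : MeasurableSpace Ω} {μ : Measure Ω}
    [IsProbabilityMeasure μ] {ℱ : Filtration ℕ m0} {X : ℕ → Ω → ℝ} {C A a L : ℝ}
    (hX : ∀ t, Measurable[ℱ t] (X t)) (hXC : ∀ t x, |X t x| ≤ C) (hA : 0 < A) (ha : 0 < a)
    (hincr : ∀ t, ∀ᵐ x ∂μ, |X (t + 1) x - X t x| ≤ A)
    (hdrift : ∀ t, ∀ᵐ x ∂μ, X t x < L → a ≤ (μ[fun y => X (t + 1) y - X t y|ℱ t]) x)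
    (hstart : ∀ᵐ x ∂μ, L ≤ X 0 x) (r : ℝ) (t : ℕ) :
    μ.real {x | X t x ≤ L - r} ≤ (t + 1) * Real.exp (a / A ^ 2 * (A - r)) := by
  have hθ : 0 < a / A ^ 2 := by positivity
  have hX0 : ∀ t, Measurable (X t) := fun t => (hX t).mono (ℱ.le t) le_rfl
  have h_integrable : ∀ t, Integrable (fun x => Real.exp (a / A ^ 2 * (L - X t x))) μ := by
    intro t
    have := hX0 t
    refine Integrable.of_bound (by fun_prop) (Real.exp (a / A ^ 2 * (L + C)))
      (ae_of_all _ fun x => ?_)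
    rw [Real.norm_eq_abs, Real.abs_exp]
    have := (abs_le.1 (hXC t x)).1
    gcongr
    linarith
  have hmoment : ∀ t : ℕ, ∫ x, Real.exp (a / A ^ 2 * (L - X t x)) ∂μ
      ≤ (t + 1) * Real.exp (a / A) := by
    intro t
    induction t with
    | zero =>
      have h1 : ∫ x, Real.exp (a / A ^ 2 * (L - X 0 x)) ∂μ ≤ ∫ _, (1 : ℝ) ∂μ := by
        refine integral_mono_ae (h_integrable 0) (integrable_const _) ?_
        filter_upwards [hstart] with x hx
        rw [Real.exp_le_one_iff]
        exact mul_nonpos_of_nonneg_of_nonpos hθ.le (by linarith)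
      have h2 : 1 ≤ Real.exp (a / A) := Real.one_le_exp (by positivity)
      simp only [integral_const, probReal_univ, smul_eq_mul, mul_one] at h1
      simpa using h1.trans h2
    | succ t ih =>
      have := integral_exp_le_of_drift (μ := μ) (ℱ.le t) (L := L) (s := {x | X t x < L})
        (hX t) (hX0 (t + 1)) (hXC t) (hXC (t + 1)) hA ha
        (hX t measurableSet_Iio) (hincr t) (hdrift t) (fun x hx => not_lt.1 hx)
      push_cast
      linarith
  have hmarkov := mul_meas_ge_le_integral_of_nonneg
    (ae_of_all μ fun x => (Real.exp_pos (a / A ^ 2 * (L - X t x))).le) (h_integrable t)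
    (Real.exp (a / A ^ 2 * r))
  have hset : {x | X t x ≤ L - r}
      ⊆ {x | Real.exp (a / A ^ 2 * r) ≤ Real.exp (a / A ^ 2 * (L - X t x))} := by
    intro x (hx : X t x ≤ L - r)
    change Real.exp (a / A ^ 2 * r) ≤ Real.exp (a / A ^ 2 * (L - X t x))
    gcongr
    linarith
  have h1 : Real.exp (a / A ^ 2 * r) * μ.real {x | X t x ≤ L - r} ≤ (t + 1) * Real.exp (a / A) :=
    (mul_le_mul_of_nonneg_left (measureReal_mono hset) (Real.exp_pos _).le).trans
      (hmarkov.trans (hmoment t))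
  have h2 : (t + 1) * Real.exp (a / A ^ 2 * (A - r))
      = (t + 1) * Real.exp (a / A) / Real.exp (a / A ^ 2 * r) := by
    rw [mul_div_assoc, ← Real.exp_sub]
    congr 2
    field_simp
  rw [h2, le_div_iff₀ (Real.exp_pos _), mul_comm]
  exact h1

/-- For `2 < exp p` and `16 * p ≤ q`, the factor `exp (-q)` absorbs `(exp p + 1) ^ 2` and leaves at
most `exp (-p)`. -/
theorem sq_exp_add_one_mul_exp_neg_le {p q : ℝ} (hp : 2 < Real.exp p) (hq : 16 * p ≤ q) :
    (Real.exp p + 1) * ((Real.exp p + 1) * Real.exp (-q)) ≤ Real.exp (-p) := by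
  have h1 : Real.exp (-q) ≤ Real.exp (-p) * Real.exp (-p) ^ 15 := by
    rw [← Real.exp_nat_mul, ← Real.exp_add]
    gcongr
    push_cast
    linarith
  set u := Real.exp p
  have hv : u * Real.exp (-p) = 1 := by rw [← Real.exp_add]; simp
  set v := Real.exp (-p)
  have hv0 : 0 < v := Real.exp_pos _
  have hv1 : v ≤ 1 / 2 := by nlinarith
  calc (u + 1) * ((u + 1) * Real.exp (-q)) ≤ (2 * u) * ((2 * u) * (v * v ^ 15)) := by
        gcongr <;> linarith
    _ = (u * v) ^ 2 * (4 * v ^ 13) * v := by ring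
    _ = 4 * v ^ 13 * v := by rw [hv]; ring
    _ ≤ 4 * (1 / 2) ^ 13 * v := by gcongr
    _ ≤ v := by nlinarith

theorem escape_time_bound_of_drift
    {Ω : Type*} {m0 : MeasurableSpace Ω} (μ : Measure Ω) [IsProbabilityMeasure μ]
    {D : Type*} [MeasurableSpace D]
    (ℱ : Filtration ℕ m0)
    (ω : ℕ → Ω → D) (hadapted : ∀ t, Measurable[ℱ t] (ω t))
    (g : D → ℝ) (hg : Measurable g)
    (A1 A2 a1 a4 : ℝ) (hA1 : 0 < A1) (hA2 : 0 < A2) (ha1 : 0 < a1)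
    (ha4 : 2 * A2 < a4)
    (B B' : Set D)
    (hBdef : B = {x : D | A1 - a4 ≤ g x})
    (hB'def : B' = {x : D | g x ≤ A1 - 2 * a4})
    (hbdd : ∀ x : D, |g x| ≤ A1)
    (hincr : ∀ t : ℕ, 1 ≤ t →
      ∀ᵐ x ∂μ, |g (ω t x) - g (ω (t - 1) x)| ≤ A2)
    (hdrift : ∀ t : ℕ, 1 ≤ t →
      ∀ᵐ x ∂μ, Set.indicator Bᶜ (fun _ => a1) (ω (t - 1) x)
        ≤ (μ[fun y => g (ω t y) - g (ω (t - 1) y)|ℱ (t - 1)]) x)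
    (hstart : ∀ᵐ x ∂μ, ω 0 x ∈ B)
    (T : ℝ) (hT : 2 * A2 / a1 < T)
    (T' : ℝ) (hT' : T' = Real.exp (min (a4 ^ 2) (a1 ^ 2 * T ^ 2) / (32 * A2 ^ 2 * T))) :
    ENNReal.ofReal (1 - Real.exp (-a4 ^ 2 / (32 * A2 ^ 2 * T))
        - Real.exp (-(a1 ^ 2 * T ^ 2) / (32 * A2 ^ 2 * T)))
      ≤ μ {x | ENNReal.ofReal T' ≤ hitTime ω B' x} := by
  subst hBdef hB'def
  have hTpos : 0 < T := lt_trans (by positivity) hT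
  have ha4pos : 0 < a4 := by linarith
  set K := 32 * A2 ^ 2 * T with hK
  have hKpos : 0 < K := by positivity
  set p := min (a4 ^ 2) (a1 ^ 2 * T ^ 2) / K with hp
  have hp0 : 0 ≤ p := by positivity
  set N := ⌈T'⌉₊ with hN
  have hT'1 : 1 ≤ T' := hT' ▸ Real.one_le_exp hp0
  set E : ℕ → Set Ω := fun t => {x | g (ω t x) ≤ A1 - 2 * a4} with hE
  have hEm : ∀ t, MeasurableSet (E t) := fun t =>
    (hg.comp ((hadapted t).mono (ℱ.le t) le_rfl)) measurableSet_Iic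
  have hincr' : ∀ t, ∀ᵐ x ∂μ, |g (ω (t + 1) x) - g (ω t x)| ≤ A2 := fun t => by
    simpa using hincr (t + 1) (by omega)
  have htail : ∀ t, μ.real (E t) ≤ (t + 1) * Real.exp (a1 / A2 ^ 2 * (A2 - a4)) := by
    intro t
    have hdrift' : ∀ t, ∀ᵐ x ∂μ, g (ω t x) < A1 - a4 →
        a1 ≤ (μ[fun y => g (ω (t + 1) y) - g (ω t y)|ℱ t]) x := by
      intro t
      have h := hdrift (t + 1) (by omega)
      rw [Nat.add_sub_cancel] at h
      filter_upwards [h] with x hx hlt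
      rwa [Set.indicator_of_mem] at hx
      exact fun h : A1 - a4 ≤ g (ω t x) => hlt.not_ge h
    have := measureReal_le_of_drift (μ := μ) (X := fun t x => g (ω t x))
      (fun t => hg.comp (hadapted t)) (fun t x => hbdd _) hA2 ha1 hincr' hdrift' hstart a4 t
    rwa [show A1 - a4 - a4 = A1 - 2 * a4 by ring] at this
  have hbad : μ.real (⋃ t ∈ Finset.range N, E t)
      ≤ Real.exp (-a4 ^ 2 / K) + Real.exp (-(a1 ^ 2 * T ^ 2) / K) := by
    refine (measureReal_biUnion_finset_le _ _).trans ?_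
    rcases le_or_gt T' 2 with hsmall | hlarge
    · have hnull : ∀ t ∈ Finset.range N, μ.real (E t) = 0 := by
        intro t ht
        have ht2 : t < 2 :=
          (Finset.mem_range.1 ht).trans_le (Nat.ceil_le.2 (by exact_mod_cast hsmall))
        have hae : ∀ᵐ x ∂μ, x ∉ E t := by
          filter_upwards [hstart, hincr' 0] with x h0 h1
          have h0 : A1 - a4 ≤ g (ω 0 x) := h0
          have h1 := (abs_le.1 h1).1
          change ¬ g (ω t x) ≤ A1 - 2 * a4
          rw [not_le]
          interval_cases t
          · linarith
          · rw [zero_add] at h1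
            linarith
        rw [measureReal_def, measure_eq_zero_iff_ae_notMem.2 hae, ENNReal.toReal_zero]
      rw [Finset.sum_eq_zero hnull]
      positivity
    · have hNT : (N : ℝ) ≤ T' + 1 := (Nat.ceil_lt_add_one (by linarith)).le
      have hexp : a1 / A2 ^ 2 * (A2 - a4) ≤ -(a1 * a4 / (2 * A2 ^ 2)) := by
        have : a1 * (A2 - a4) ≤ -(a1 * a4 / 2) := by nlinarith
        calc a1 / A2 ^ 2 * (A2 - a4) = a1 * (A2 - a4) / A2 ^ 2 := by ring
          _ ≤ -(a1 * a4 / 2) / A2 ^ 2 := by gcongr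
          _ = _ := by field_simp
      have hpq : 16 * p ≤ a1 * a4 / (2 * A2 ^ 2) := by
        have hmin : min (a4 ^ 2) (a1 ^ 2 * T ^ 2) ≤ a4 * (a1 * T) := by
          rcases le_total a4 (a1 * T) with h | h
          · exact (min_le_left _ _).trans (by nlinarith)
          · exact (min_le_right _ _).trans (by nlinarith [mul_pos ha1 hTpos])
        calc 16 * p ≤ 16 * (a4 * (a1 * T) / K) := by rw [hp]; gcongr
          _ = _ := by rw [hK]; field_simp; norm_num
      have hsum : ∑ t ∈ Finset.range N, μ.real (E t)
          ≤ (T' + 1) * ((T' + 1) * Real.exp (-(a1 * a4 / (2 * A2 ^ 2)))) := by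
        calc ∑ t ∈ Finset.range N, μ.real (E t)
            ≤ ∑ _t ∈ Finset.range N, (T' + 1) * Real.exp (-(a1 * a4 / (2 * A2 ^ 2))) := by
              refine Finset.sum_le_sum fun t ht => (htail t).trans ?_
              have := Nat.lt_ceil.1 (Finset.mem_range.1 ht)
              gcongr
          _ = N * ((T' + 1) * Real.exp (-(a1 * a4 / (2 * A2 ^ 2)))) := by simp
          _ ≤ _ := by gcongr
      refine hsum.trans ?_
      rw [hT'] at hlarge ⊢
      refine (sq_exp_add_one_mul_exp_neg_le hlarge hpq).trans ?_
      rcases min_cases (a4 ^ 2) (a1 ^ 2 * T ^ 2) with h | h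
      · rw [hp, h.1, ← neg_div]
        exact le_add_of_nonneg_right (Real.exp_pos _).le
      · rw [hp, h.1, ← neg_div]
        exact le_add_of_nonneg_left (Real.exp_pos _).le
  have hsub : (⋃ t ∈ Finset.range N, E t)ᶜ
      ⊆ {x | ENNReal.ofReal T' ≤ hitTime ω {x : D | g x ≤ A1 - 2 * a4} x} := by
    intro x hx
    change ENNReal.ofReal T' ≤ ⨅ t ∈ {t : ℕ | g (ω t x) ≤ A1 - 2 * a4}, (t : ℝ≥0∞)
    refine le_iInf₂ fun t ht => ?_
    have hle : T' ≤ t := by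
      by_contra! hlt
      exact hx (Set.mem_biUnion (Finset.mem_coe.2 (Finset.mem_range.2 (Nat.lt_ceil.2 hlt))) ht)
    exact (ENNReal.ofReal_le_ofReal hle).trans_eq (ENNReal.ofReal_natCast t)
  refine le_trans ?_ (measure_mono hsub)
  rw [← ofReal_measureReal,
    probReal_compl_eq_one_sub (Finset.measurableSet_biUnion _ fun t _ => hEm t)]
  exact ENNReal.ofReal_le_ofReal (by linarith)
end

section
/- Let (ω_t) be an irreducible Markov chain on a finite state space M with stationary distribution π. Let A, B ⊆ M be nonempty and disjoint, and set t1 = max_{x ∈ B} E_x[τ(A)] and t2 = min_{x ∈ A} E_x[τ(B)], where τ(·) denotes the first hitting time of the indicated set and E_x the expectation for the chain started at x. Then π(B) ≤ t1/(t1 + t2). -/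
/- STATEMENT 6: For an irreducible Markov chain on a finite state space with stationary
   distribution π, and disjoint nonempty sets A, B, with t1 the maximal expected hitting
   time of A from B and t2 the minimal expected hitting time of B from A, one has
   π(B) ≤ t1/(t1+t2). -/

open scoped BigOperators ENNReal NNReal

/-- The transition matrix with rows in `A` killed (used to compute hitting times of `A`). -/
noncomputable def killedMatrix {M : Type*} [Fintype M] [DecidableEq M]
    (P : Matrix M M ℝ) (A : Finset M) : Matrix M M ℝ :=
  fun x y => if x ∈ A then 0 else P x y

/-- The expected hitting time `E_x[τ(A)] = Σ_{t ≥ 0} P_x(τ(A) > t)`, expressed through the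
killed transition matrix: `P_x(τ(A) > t) = Σ_{y ∉ A} (Q^t)_{x,y}` where `Q` is `P` with the
rows of `A` killed.  Valued in `ℝ≥0∞`. -/
noncomputable def expectedHittingTime {M : Type*} [Fintype M] [DecidableEq M]
    (P : Matrix M M ℝ) (A : Finset M) (x : M) : ℝ≥0∞ :=
  ∑' t : ℕ, ENNReal.ofReal (∑ y ∈ Finset.univ.filter (fun y => y ∉ A),
    (killedMatrix P A ^ t) x y)

open Finset

/-- The probability that the chain started from `x` avoids `A` up to time `t`. -/
noncomputable def avoidProb {M : Type*} [Fintype M] [DecidableEq M]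
    (P : Matrix M M ℝ) (A : Finset M) (t : ℕ) (x : M) : ℝ :=
  ∑ y ∈ Finset.univ.filter (fun y => y ∉ A), (killedMatrix P A ^ t) x y

section

variable {M : Type*} [Fintype M] [DecidableEq M] {P : Matrix M M ℝ}

lemma avoidProb_zero (A : Finset M) (x : M) :
    avoidProb P A 0 x = if x ∈ A then 0 else 1 := by
  simp [avoidProb, Matrix.one_apply]

lemma avoidProb_succ (A : Finset M) (t : ℕ) (x : M) :
    avoidProb P A (t + 1) x = if x ∈ A then 0 else ∑ z, P x z * avoidProb P A t z := by
  simp only [avoidProb, pow_succ', Matrix.mul_apply]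
  rw [sum_comm]
  split_ifs with hx <;> simp [killedMatrix, hx, mul_sum]

lemma avoidProb_nonneg (hP : ∀ x y, 0 ≤ P x y) (A : Finset M) (t : ℕ) (x : M) :
    0 ≤ avoidProb P A t x := by
  induction t generalizing x with
  | zero => rw [avoidProb_zero]; split_ifs <;> simp
  | succ t ih =>
    rw [avoidProb_succ]
    split_ifs
    · rfl
    · exact sum_nonneg fun z _ => mul_nonneg (hP x z) (ih z)

lemma avoidProb_of_mem {A : Finset M} {x : M} (hx : x ∈ A) (t : ℕ) :
    avoidProb P A t x = 0 := by
  cases t <;> simp [avoidProb_zero, avoidProb_succ, hx]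

lemma sum_avoidProb_succ {A : Finset M} {x : M} (hx : x ∉ A) (T : ℕ) :
    ∑ t ∈ range (T + 1), avoidProb P A t x =
      1 + ∑ z, P x z * ∑ t ∈ range T, avoidProb P A t z := by
  rw [sum_range_succ', avoidProb_zero, if_neg hx, add_comm]
  simp only [avoidProb_succ, if_neg hx, mul_sum]
  rw [sum_comm]

lemma stationary_pow {π : M → ℝ} (hπstat : ∀ y, ∑ x, π x * P x y = π y) (n : ℕ) (y : M) :
    ∑ x, π x * (P ^ n) x y = π y := by
  have h : Matrix.vecMul π P = π := funext hπstat
  have h' : Matrix.vecMul π (P ^ n) = π := by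
    induction n with
    | zero => simp
    | succ n ih => rw [pow_succ, ← Matrix.vecMul_vecMul, ih, h]
  exact congrFun h' y

lemma pow_apply_nonneg (hP : ∀ x y, 0 ≤ P x y) (n : ℕ) (x y : M) : 0 ≤ (P ^ n) x y := by
  induction n generalizing y with
  | zero => rw [pow_zero, Matrix.one_apply]; split_ifs <;> simp
  | succ n ih =>
    rw [pow_succ, Matrix.mul_apply]
    exact sum_nonneg fun z _ => mul_nonneg (ih z) (hP z y)

lemma stationary_pos (hP : ∀ x y, 0 ≤ P x y) (hirr : ∀ x y : M, ∃ n : ℕ, 0 < (P ^ n) x y)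
    {π : M → ℝ} (hπ : ∀ x, 0 ≤ π x) (hπsum : ∑ x, π x = 1)
    (hπstat : ∀ y, ∑ x, π x * P x y = π y) (y : M) : 0 < π y := by
  obtain ⟨x, -, hx⟩ : ∃ x ∈ univ, 0 < π x := by
    by_contra! h
    linarith [sum_nonpos h]
  obtain ⟨n, hn⟩ := hirr x y
  rw [← stationary_pow hπstat n y]
  exact sum_pos' (fun z _ => mul_nonneg (hπ z) (pow_apply_nonneg hP n z y))
    ⟨x, mem_univ x, mul_pos hx hn⟩

/-- A form of Kac's lemma: the truncated mean return time to a point of `A` is bounded. -/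
lemma stationary_mul_sum_avoidProb_le (hP : ∀ x y, 0 ≤ P x y)
    {π : M → ℝ} (hπ : ∀ x, 0 ≤ π x) (hπsum : ∑ x, π x = 1)
    (hπstat : ∀ y, ∑ x, π x * P x y = π y) {A : Finset M} {a : M} (ha : a ∈ A) (T : ℕ) :
    π a * ∑ z, P a z * ∑ t ∈ range T, avoidProb P A t z ≤ 1 := by
  set H : M → ℝ := fun z => ∑ t ∈ range T, avoidProb P A t z with hH
  have hH0 : ∀ z, 0 ≤ H z := fun z => sum_nonneg fun t _ => avoidProb_nonneg hP A t z
  have hPH : ∀ x, 0 ≤ ∑ z, P x z * H z := fun x =>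
    sum_nonneg fun z _ => mul_nonneg (hP x z) (hH0 z)
  have hinv : ∑ x, π x * ∑ z, P x z * H z = ∑ z, π z * H z := by
    simp only [mul_sum, ← mul_assoc]
    rw [sum_comm]
    simp only [← sum_mul, hπstat]
  have hle : ∀ x, (if x ∈ A then π x * ∑ z, P x z * H z else 0) ≤
      π x + π x * (∑ z, P x z * H z) - π x * H x := by
    intro x
    split_ifs with hx
    · have : H x = 0 := sum_eq_zero fun t _ => avoidProb_of_mem hx t
      rw [this]
      linarith [hπ x]
    · have h1 := sum_avoidProb_succ (P := P) hx T
      have h2 : H x ≤ 1 + ∑ z, P x z * H z := by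
        rw [hH, ← h1, sum_range_succ]
        linarith [avoidProb_nonneg hP A T x]
      linarith [mul_le_mul_of_nonneg_left h2 (hπ x)]
  have hsum := sum_le_sum fun x (_ : x ∈ univ) => hle x
  rw [sum_sub_distrib, sum_add_distrib, hπsum, hinv, add_sub_cancel_right] at hsum
  refine le_trans ?_ hsum
  have := single_le_sum (f := fun x => if x ∈ A then π x * ∑ z, P x z * H z else 0)
    (fun x _ => by
      split_ifs
      · exact mul_nonneg (hπ x) (hPH x)
      · rfl) (mem_univ a)
  simpa [ha] using this

lemma sum_avoidProb_bounded (hP : ∀ x y, 0 ≤ P x y)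
    (hirr : ∀ x y : M, ∃ n : ℕ, 0 < (P ^ n) x y)
    {π : M → ℝ} (hπ : ∀ x, 0 ≤ π x) (hπsum : ∑ x, π x = 1)
    (hπstat : ∀ y, ∑ x, π x * P x y = π y) {A : Finset M} (hA : A.Nonempty) (x : M) :
    ∃ C : ℝ, ∀ T, ∑ t ∈ range T, avoidProb P A t x ≤ C := by
  obtain ⟨a, ha⟩ := hA
  have hH0 : ∀ T z, 0 ≤ ∑ t ∈ range T, avoidProb P A t z := fun T z =>
    sum_nonneg fun t _ => avoidProb_nonneg hP A t z
  have hnext : ∀ z, (∃ C : ℝ, ∀ T, ∑ t ∈ range T, avoidProb P A t z ≤ C) →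
      ∃ C : ℝ, ∀ T, ∑ w, P z w * ∑ t ∈ range T, avoidProb P A t w ≤ C := by
    rintro z ⟨C, hC⟩
    by_cases hz : z ∈ A
    · have hpos := stationary_pos hP hirr hπ hπsum hπstat z
      refine ⟨1 / π z, fun T => ?_⟩
      rw [le_div_iff₀' hpos]
      exact stationary_mul_sum_avoidProb_le hP hπ hπsum hπstat hz T
    · refine ⟨C, fun T => ?_⟩
      have := hC (T + 1)
      rw [sum_avoidProb_succ hz] at this
      linarith
  have hstep : ∀ z w, 0 < P z w → (∃ C : ℝ, ∀ T, ∑ t ∈ range T, avoidProb P A t z ≤ C) →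
      ∃ C : ℝ, ∀ T, ∑ t ∈ range T, avoidProb P A t w ≤ C := by
    intro z w hzw hz
    obtain ⟨C, hC⟩ := hnext z hz
    refine ⟨C / P z w, fun T => ?_⟩
    rw [le_div_iff₀' hzw]
    exact (single_le_sum (f := fun w => P z w * ∑ t ∈ range T, avoidProb P A t w)
      (fun w _ => mul_nonneg (hP z w) (hH0 T w)) (mem_univ w)).trans (hC T)
  have hreach : ∀ (n : ℕ) (w : M), 0 < (P ^ n) a w →
      ∃ C : ℝ, ∀ T, ∑ t ∈ range T, avoidProb P A t w ≤ C := by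
    intro n
    induction n with
    | zero =>
      intro w hw
      obtain rfl : a = w := by
        by_contra h
        simp [h] at hw
      exact ⟨0, fun T => (sum_eq_zero fun t _ => avoidProb_of_mem ha t).le⟩
    | succ n ih =>
      intro w hw
      rw [pow_succ, Matrix.mul_apply] at hw
      obtain ⟨z, -, hz⟩ := exists_lt_of_sum_lt (s := univ) (f := fun _ : M => (0 : ℝ))
        (by simpa using hw)
      have hz1 : 0 < (P ^ n) a z := pos_of_mul_pos_left hz (hP z w)
      exact hstep z w (pos_of_mul_pos_right hz hz1.le) (ih z hz1)
  obtain ⟨n, hn⟩ := hirr a x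
  exact hreach n x hn

/-- Expected hitting times are finite and satisfy the first-step equations. -/
lemma exists_expectedHittingTime_eq (hP : ∀ x y, 0 ≤ P x y)
    (hirr : ∀ x y : M, ∃ n : ℕ, 0 < (P ^ n) x y)
    {π : M → ℝ} (hπ : ∀ x, 0 ≤ π x) (hπsum : ∑ x, π x = 1)
    (hπstat : ∀ y, ∑ x, π x * P x y = π y) {A : Finset M} (hA : A.Nonempty) :
    ∃ h : M → ℝ, (∀ x, expectedHittingTime P A x = ENNReal.ofReal (h x)) ∧ (∀ x, 0 ≤ h x) ∧
      (∀ x ∈ A, h x = 0) ∧ ∀ x ∉ A, h x = 1 + ∑ z, P x z * h z := by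
  have hs : ∀ x, Summable fun t => avoidProb P A t x := fun x => by
    obtain ⟨C, hC⟩ := sum_avoidProb_bounded hP hirr hπ hπsum hπstat hA x
    exact summable_of_sum_range_le (fun t => avoidProb_nonneg hP A t x) hC
  refine ⟨fun x => ∑' t, avoidProb P A t x, fun x => ?_, fun x => ?_, fun x hx => ?_,
    fun x hx => ?_⟩
  · exact (ENNReal.ofReal_tsum_of_nonneg (fun t => avoidProb_nonneg hP A t x) (hs x)).symm
  · exact tsum_nonneg fun t => avoidProb_nonneg hP A t x
  · simp [avoidProb_of_mem hx]
  · dsimp only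
    rw [(hs x).tsum_eq_zero_add, avoidProb_zero, if_neg hx]
    simp only [avoidProb_succ, if_neg hx]
    rw [Summable.tsum_finsetSum fun z _ => (hs z).mul_left _]
    simp only [tsum_mul_left]

/-- The part of `π` on which the last visit to `A ∪ B` was a visit to `B`. -/
lemma exists_lastVisit_measure (hP : ∀ x y, 0 ≤ P x y) {π : M → ℝ} (hπ : ∀ x, 0 ≤ π x)
    (hπstat : ∀ y, ∑ x, π x * P x y = π y) {A B : Finset M} (hAB : Disjoint A B) :
    ∃ μ : M → ℝ, (∀ x, 0 ≤ μ x) ∧ (∀ x, μ x ≤ π x) ∧ (∀ x ∈ A, μ x = 0) ∧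
      (∀ x ∈ B, μ x = π x) ∧ ∀ y, y ∉ A → y ∉ B → ∑ x, μ x * P x y = μ y := by
  have : Fact ((0 : M → ℝ) ≤ π) := ⟨hπ⟩
  let F : Set.Icc (0 : M → ℝ) π →o Set.Icc (0 : M → ℝ) π :=
    { toFun := fun μ => ⟨fun y => if y ∈ A then 0 else if y ∈ B then π y else
        ∑ x, μ.1 x * P x y, by
          constructor <;> intro y <;> dsimp only <;> split_ifs
          · rfl
          · exact hπ y
          · exact sum_nonneg fun x _ => mul_nonneg (μ.2.1 x) (hP x y)
          · exact hπ y
          · rfl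
          · rw [← hπstat y]
            exact sum_le_sum fun x _ => mul_le_mul_of_nonneg_right (μ.2.2 x) (hP x y)⟩
      monotone' := by
        intro μ ν hμν y
        dsimp only
        split_ifs
        · rfl
        · rfl
        · exact sum_le_sum fun x _ => mul_le_mul_of_nonneg_right (hμν x) (hP x y) }
  have hfix : ∀ y, (if y ∈ A then 0 else if y ∈ B then π y else
      ∑ x, (OrderHom.lfp F).1 x * P x y) = (OrderHom.lfp F).1 y := fun y =>
    congrFun (congrArg Subtype.val (OrderHom.map_lfp F)) y
  refine ⟨(OrderHom.lfp F).1, (OrderHom.lfp F).2.1, (OrderHom.lfp F).2.2, fun x hx => ?_,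
    fun x hx => ?_, fun y hyA hyB => ?_⟩
  · rw [← hfix x, if_pos hx]
  · rw [← hfix x, if_neg (disjoint_right.mp hAB hx), if_pos hx]
  · rw [← hfix y, if_neg hyA, if_neg hyB]

/-- The mass of a measure vanishing on `A`, in terms of its flux and the hitting times of `A`. -/
lemma sum_eq_sum_flux_mul {A : Finset M} {h μ : M → ℝ} (hh : ∀ x ∉ A, h x = 1 + ∑ z, P x z * h z)
    (hμ : ∀ x ∈ A, μ x = 0) : ∑ x, μ x = ∑ y, (μ y - ∑ x, μ x * P x y) * h y := by
  have h1 : ∀ x, μ x = μ x * h x - ∑ z, μ x * P x z * h z := fun x => by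
    by_cases hx : x ∈ A
    · simp [hμ x hx]
    · simp only [mul_assoc, ← mul_sum]
      rw [← mul_sub, hh x hx]
      ring
  rw [sum_congr rfl fun x _ => h1 x, sum_sub_distrib, sum_comm]
  simp only [sub_mul, sum_mul, sum_sub_distrib]

/-- A flux bound on the `π`-mass of `B` by real bounds on the hitting time functions. -/
lemma stationary_mul_add_le (hP : ∀ x y, 0 ≤ P x y) (hProw : ∀ x, ∑ y, P x y = 1)
    {π : M → ℝ} (hπ : ∀ x, 0 ≤ π x) (hπsum : ∑ x, π x = 1)
    (hπstat : ∀ y, ∑ x, π x * P x y = π y) {A B : Finset M} (hAB : Disjoint A B)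
    {f g : M → ℝ} (hf0 : ∀ x ∈ A, f x = 0) (hf : ∀ x ∉ A, f x = 1 + ∑ z, P x z * f z)
    (hg0 : ∀ x ∈ B, g x = 0) (hg : ∀ x ∉ B, g x = 1 + ∑ z, P x z * g z)
    {s t : ℝ} (hs0 : 0 ≤ s) (ht0 : 0 ≤ t) (hs : ∀ x ∈ B, f x ≤ s) (ht : ∀ x ∈ A, t ≤ g x) :
    (∑ x ∈ B, π x) * (s + t) ≤ s := by
  obtain ⟨μ, hμ0, hμπ, hμA, hμB, hμ⟩ := exists_lastVisit_measure hP hπ hπstat hAB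
  have hBm : ∑ x ∈ B, π x ≤ ∑ x, μ x := by
    rw [← sum_congr rfl hμB]
    exact sum_le_sum_of_subset_of_nonneg (subset_univ B) fun x _ _ => hμ0 x
  have hfluxA : ∀ y ∈ A, μ y - ∑ x, μ x * P x y ≤ 0 := fun y hy => by
    rw [hμA y hy, zero_sub, neg_nonpos]
    exact sum_nonneg fun x _ => mul_nonneg (hμ0 x) (hP x y)
  have hfluxB : ∀ y ∈ B, 0 ≤ μ y - ∑ x, μ x * P x y := fun y hy => by
    rw [hμB y hy, ← hπstat y, sub_nonneg]
    exact sum_le_sum fun x _ => mul_le_mul_of_nonneg_right (hμπ x) (hP x y)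
  have hfluxC : ∀ y, y ∉ A → y ∉ B → μ y - ∑ x, μ x * P x y = 0 := fun y hyA hyB => by
    rw [hμ y hyA hyB, sub_self]
  have hm1 := sum_eq_sum_flux_mul hf hμA
  have hm2 := sum_eq_sum_flux_mul (P := P) (μ := fun x => π x - μ x) hg fun x hx => by
    rw [hμB x hx, sub_self]
  have hm2 : 1 - ∑ x, μ x = ∑ y, -(μ y - ∑ x, μ x * P x y) * g y := by
    rw [← hπsum, ← sum_sub_distrib, hm2]
    refine sum_congr rfl fun y _ => ?_
    simp only [sub_mul, sum_sub_distrib, hπstat]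
    ring
  have htot : ∑ y, (μ y - ∑ x, μ x * P x y) = 0 := by
    rw [sum_sub_distrib, sum_comm]
    simp only [← mul_sum, hProw, mul_one, sub_self]
  set J : M → ℝ := fun y => μ y - ∑ x, μ x * P x y
  have hle1 : ∑ x, μ x ≤ (∑ y ∈ B, J y) * s := by
    rw [hm1, sum_mul, ← sum_subset (subset_univ B)]
    · exact sum_le_sum fun y hy => mul_le_mul_of_nonneg_left (hs y hy) (hfluxB y hy)
    · intro y _ hy
      by_cases hyA : y ∈ A
      · rw [hf0 y hyA, mul_zero]
      · rw [hfluxC y hyA hy, zero_mul]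
  have hle2 : (∑ y ∈ A, -J y) * t ≤ 1 - ∑ x, μ x := by
    rw [hm2, sum_mul, ← sum_subset (subset_univ A)]
    · exact sum_le_sum fun y hy =>
        mul_le_mul_of_nonneg_left (ht y hy) (neg_nonneg.mpr (hfluxA y hy))
    · intro y _ hy
      by_cases hyB : y ∈ B
      · rw [hg0 y hyB, mul_zero]
      · rw [hfluxC y hy hyB, neg_zero, zero_mul]
  have hflux : ∑ y ∈ A, -J y = ∑ y ∈ B, J y := by
    have : ∑ y ∈ A ∪ B, J y = 0 := by
      rw [← htot]
      refine sum_subset (subset_univ _) fun y _ hy => ?_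
      rw [mem_union, not_or] at hy
      exact hfluxC y hy.1 hy.2
    rw [sum_union hAB] at this
    rw [sum_neg_distrib]
    linarith
  rw [hflux] at hle2
  have h1 := mul_le_mul_of_nonneg_right hle1 ht0
  have h2 := mul_le_mul_of_nonneg_left hle2 hs0
  have h3 := mul_le_mul_of_nonneg_right hBm (add_nonneg hs0 ht0)
  linarith

end

theorem stationary_le_hittingTime_ratio
    {M : Type*} [Fintype M] [DecidableEq M] [Nonempty M]
    (P : Matrix M M ℝ)
    (hPnonneg : ∀ x y, 0 ≤ P x y)
    (hProw : ∀ x, ∑ y : M, P x y = 1)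
    (hirr : ∀ x y : M, ∃ n : ℕ, 0 < (P ^ n) x y)
    (π : M → ℝ)
    (hπnonneg : ∀ x, 0 ≤ π x) (hπsum : ∑ x : M, π x = 1)
    (hπstat : ∀ y : M, ∑ x : M, π x * P x y = π y)
    (A B : Finset M) (hA : A.Nonempty) (hB : B.Nonempty) (hAB : Disjoint A B)
    (t1 t2 : ℝ≥0∞)
    (ht1 : t1 = ⨆ x ∈ B, expectedHittingTime P A x)
    (ht2 : t2 = ⨅ x ∈ A, expectedHittingTime P B x) :
    ENNReal.ofReal (∑ x ∈ B, π x) ≤ t1 / (t1 + t2) := by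
  obtain ⟨f, hf, hfnn, hf0, hf1⟩ :=
    exists_expectedHittingTime_eq hPnonneg hirr hπnonneg hπsum hπstat hA
  obtain ⟨g, hg, hgnn, hg0, hg1⟩ :=
    exists_expectedHittingTime_eq hPnonneg hirr hπnonneg hπsum hπstat hB
  obtain ⟨b, hb, hbmax⟩ := exists_max_image B f hB
  obtain ⟨a, ha, hamin⟩ := exists_min_image A g hA
  have e1 : t1 = ENNReal.ofReal (f b) := by
    simp only [ht1, hf]
    exact le_antisymm (iSup₂_le fun x hx => ENNReal.ofReal_le_ofReal (hbmax x hx))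
      (le_iSup₂_of_le b hb le_rfl)
  have e2 : t2 = ENNReal.ofReal (g a) := by
    simp only [ht2, hg]
    exact le_antisymm (iInf₂_le_of_le a ha le_rfl)
      (le_iInf₂ fun x hx => ENNReal.ofReal_le_ofReal (hamin x hx))
  have hpos : 0 < f b + g a := by
    have := hg1 a (disjoint_left.mp hAB ha)
    have := sum_nonneg fun z (_ : z ∈ univ) => mul_nonneg (hPnonneg a z) (hgnn z)
    linarith [hfnn b]
  rw [e1, e2, ← ENNReal.ofReal_add (hfnn b) (hgnn a), ← ENNReal.ofReal_div_of_pos hpos]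
  apply ENNReal.ofReal_le_ofReal
  rw [le_div_iff₀ hpos]
  exact stationary_mul_add_le hPnonneg hProw hπnonneg hπsum hπstat hAB hf0 hf1 hg0 hg1
    (hfnn b) (hgnn a) hbmax hamin
end

section
/- (Thomson's principle.) Let G be a finite simple graph with vertex set V and let F : V → ℝ. Let θ be any antisymmetric real-valued function on ordered pairs of adjacent vertices such that div θ(v) = div(∇F)(v) for every v ∈ V, where div f(v) = Σ_{w ∼ v} f(w,v). Then E(∇F) ≤ E(θ), where E(f) = (1/2)·Σ_{(v,w) : v∼w} f(v,w)² and ∇F(v,w) = F(w) − F(v). -/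
/-- A gradient is orthogonal to every divergence-free antisymmetric flow. -/
theorem SimpleGraph.sum_gradient_mul_eq_zero {V R : Type*} [Fintype V] [CommRing R]
    (G : SimpleGraph V) [DecidableRel G.Adj] (F : V → R) (f : V → V → R)
    (hanti : ∀ v w, f w v = -f v w)
    (hdiv : ∀ v, ∑ w ∈ G.neighborFinset v, f w v = 0) :
    ∑ v, ∑ w ∈ G.neighborFinset v, (F w - F v) * f v w = 0 := by
  have head : ∑ v, ∑ w ∈ G.neighborFinset v, F w * f v w = 0 := by
    rw [Finset.sum_comm' (t' := Finset.univ) (s' := fun w => G.neighborFinset w)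
      (by simp [G.adj_comm])]
    simp [← Finset.mul_sum, hdiv]
  have tail : ∑ v, ∑ w ∈ G.neighborFinset v, F v * f v w = 0 := by
    refine Finset.sum_eq_zero fun v _ => ?_
    rw [← Finset.mul_sum, Finset.sum_congr rfl fun w _ => hanti w v,
      Finset.sum_neg_distrib, hdiv, neg_zero, mul_zero]
  simp only [sub_mul, Finset.sum_sub_distrib, head, tail, sub_zero]


/- STATEMENT 8: Thomson's principle: among all flows with the same divergence as the
   gradient flow `∇F`, the gradient flow minimizes the energy. -/

theorem thomson_principle
    {V : Type*} [Fintype V] [DecidableEq V]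
    (G : SimpleGraph V) [DecidableRel G.Adj] (F : V → ℝ) (θ : V → V → ℝ)
    (hanti : ∀ v w, θ w v = -θ v w)
    (hsupp : ∀ v w, ¬ G.Adj v w → θ v w = 0)
    (hdiv : ∀ v : V, ∑ w ∈ G.neighborFinset v, θ w v
      = ∑ w ∈ G.neighborFinset v, (F v - F w)) :
    (1 / 2) * ∑ v : V, ∑ w ∈ G.neighborFinset v, (F w - F v) ^ 2
      ≤ (1 / 2) * ∑ v : V, ∑ w ∈ G.neighborFinset v, (θ v w) ^ 2 := by
  have cross := G.sum_gradient_mul_eq_zero F (fun v w => θ v w - (F w - F v))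
    (fun v w => by rw [hanti v w]; ring)
    (fun v => by rw [Finset.sum_sub_distrib, hdiv v, sub_self])
  have expand : ∑ v, ∑ w ∈ G.neighborFinset v, θ v w ^ 2
      = ∑ v, ∑ w ∈ G.neighborFinset v, (F w - F v) ^ 2
        + 2 * ∑ v, ∑ w ∈ G.neighborFinset v, (F w - F v) * (θ v w - (F w - F v))
        + ∑ v, ∑ w ∈ G.neighborFinset v, (θ v w - (F w - F v)) ^ 2 := by
    simp only [Finset.mul_sum, ← Finset.sum_add_distrib]
    refine Finset.sum_congr rfl fun v _ => Finset.sum_congr rfl fun w _ => ?_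
    ring
  have nonneg : 0 ≤ ∑ v, ∑ w ∈ G.neighborFinset v, (θ v w - (F w - F v)) ^ 2 := by
    positivity
  linarith
end

section
/- Let G be a finite simple graph with vertex set V and let θ0 be a flow on G, i.e. an antisymmetric real-valued function on ordered pairs of adjacent vertices. Then among all flows θ on G with div θ = div θ0, there exists exactly one flow minimizing the energy E(θ) = (1/2)·Σ_{(v,w) : v∼w} θ(v,w)². -/
/- STATEMENT 9: Among all flows on a finite simple graph having a prescribed divergence
   (namely, the divergence of a given flow `θ0`), there is exactly one flow of minimal
   energy. -/

/-- `IsFlow G θ` : `θ` is a flow on the graph `G`, i.e. an antisymmetric function on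
ordered pairs of vertices supported on adjacent pairs. -/
def IsFlow {V : Type*} (G : SimpleGraph V) (θ : V → V → ℝ) : Prop :=
  (∀ v w, θ w v = -θ v w) ∧ (∀ v w, ¬ G.Adj v w → θ v w = 0)

/-- The divergence of a flow at a vertex. -/
noncomputable def flowDiv {V : Type*} [Fintype V] [DecidableEq V]
    (G : SimpleGraph V) [DecidableRel G.Adj] (θ : V → V → ℝ) (v : V) : ℝ :=
  ∑ w ∈ G.neighborFinset v, θ w v

/-- The energy of a flow. -/
noncomputable def flowEnergy {V : Type*} [Fintype V] [DecidableEq V]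
    (G : SimpleGraph V) [DecidableRel G.Adj] (θ : V → V → ℝ) : ℝ :=
  (1 / 2) * ∑ v : V, ∑ w ∈ G.neighborFinset v, (θ v w) ^ 2

theorem IsFlow.sub {V : Type*} {G : SimpleGraph V} {θ η : V → V → ℝ}
    (hθ : IsFlow G θ) (hη : IsFlow G η) : IsFlow G (θ - η) := by
  refine ⟨fun v w => ?_, fun v w h => ?_⟩
  · simp only [Pi.sub_apply, hθ.1 v w, hη.1 v w]
    ring
  · simp [hθ.2 v w h, hη.2 v w h]

theorem IsFlow.midpoint {V : Type*} {G : SimpleGraph V} {θ η : V → V → ℝ}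
    (hθ : IsFlow G θ) (hη : IsFlow G η) : IsFlow G (fun v w => (θ v w + η v w) / 2) := by
  refine ⟨fun v w => ?_, fun v w h => ?_⟩
  · simp only [hθ.1 v w, hη.1 v w]
    ring
  · simp [hθ.2 v w h, hη.2 v w h]

theorem isClosed_setOf_isFlow {V : Type*} (G : SimpleGraph V) :
    IsClosed {θ : V → V → ℝ | IsFlow G θ} := by
  simp only [IsFlow, Set.ofPred_and, Set.ofPred_forall]
  refine IsClosed.inter ?_ ?_
  · exact isClosed_iInter fun v => isClosed_iInter fun w =>
      isClosed_eq (by fun_prop) (by fun_prop)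
  · exact isClosed_iInter fun v => isClosed_iInter fun w => isClosed_iInter fun _ =>
      isClosed_eq (by fun_prop) (by fun_prop)

section FiniteGraph

variable {V : Type*} [Fintype V] [DecidableEq V] (G : SimpleGraph V) [DecidableRel G.Adj]

theorem continuous_flowDiv (v : V) : Continuous fun θ : V → V → ℝ => flowDiv G θ v := by
  unfold flowDiv
  fun_prop

theorem continuous_flowEnergy : Continuous (flowEnergy G) := by
  unfold flowEnergy
  fun_prop

theorem flowDiv_midpoint (θ η : V → V → ℝ) (v : V) :
    flowDiv G (fun v w => (θ v w + η v w) / 2) v = (flowDiv G θ v + flowDiv G η v) / 2 := by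
  simp only [flowDiv, ← Finset.sum_div, Finset.sum_add_distrib]

/-- The parallelogram identity for the energy. -/
theorem flowEnergy_midpoint (θ η : V → V → ℝ) :
    flowEnergy G (fun v w => (θ v w + η v w) / 2) =
      (flowEnergy G θ + flowEnergy G η) / 2 - flowEnergy G (θ - η) / 4 := by
  have h (a b : ℝ) : ((a + b) / 2) ^ 2 = a ^ 2 / 2 + b ^ 2 / 2 - (a - b) ^ 2 / 4 := by ring
  simp only [flowEnergy, Pi.sub_apply, h, Finset.sum_sub_distrib, Finset.sum_add_distrib,
    ← Finset.sum_div]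
  ring

variable {G}

theorem IsFlow.sq_le_two_mul_flowEnergy {θ : V → V → ℝ} (hθ : IsFlow G θ) (v w : V) :
    θ v w ^ 2 ≤ 2 * flowEnergy G θ := by
  have hrow (u : V) : 0 ≤ ∑ x ∈ G.neighborFinset u, θ u x ^ 2 :=
    Finset.sum_nonneg fun x _ => sq_nonneg (θ u x)
  have htotal : ∑ x ∈ G.neighborFinset v, θ v x ^ 2 ≤ 2 * flowEnergy G θ := by
    have := Finset.single_le_sum (fun u _ => hrow u) (Finset.mem_univ v)
    unfold flowEnergy
    linarith
  refine le_trans ?_ htotal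
  by_cases h : G.Adj v w
  · exact Finset.single_le_sum (f := fun x => θ v x ^ 2) (fun x _ => sq_nonneg _)
      ((G.mem_neighborFinset v w).2 h)
  · simpa [hθ.2 v w h] using hrow v

theorem isCompact_setOf_isFlow_flowEnergy_le (c : ℝ) :
    IsCompact {θ : V → V → ℝ | IsFlow G θ ∧ flowEnergy G θ ≤ c} := by
  refine (isCompact_Icc (a := fun _ _ : V => -(2 * c + 1))
    (b := fun _ _ : V => 2 * c + 1)).of_isClosed_subset ?_ ?_
  · exact (isClosed_setOf_isFlow G).inter
      (isClosed_le (continuous_flowEnergy G) continuous_const)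
  · rintro θ ⟨hθ, hc⟩
    refine ⟨fun v w => ?_, fun v w => ?_⟩ <;>
      nlinarith [hθ.sq_le_two_mul_flowEnergy v w, sq_nonneg (θ v w - 1), sq_nonneg (θ v w + 1)]

end FiniteGraph

theorem existsUnique_energy_minimizing_flow
    {V : Type*} [Fintype V] [DecidableEq V]
    (G : SimpleGraph V) [DecidableRel G.Adj] (θ0 : V → V → ℝ) (hθ0 : IsFlow G θ0) :
    ∃! θ : V → V → ℝ,
      IsFlow G θ ∧ (∀ v, flowDiv G θ v = flowDiv G θ0 v) ∧
      ∀ θ' : V → V → ℝ, IsFlow G θ' → (∀ v, flowDiv G θ' v = flowDiv G θ0 v) →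
        flowEnergy G θ ≤ flowEnergy G θ' := by
  let K := {θ : V → V → ℝ | IsFlow G θ ∧ flowEnergy G θ ≤ flowEnergy G θ0} ∩
    {θ | ∀ v, flowDiv G θ v = flowDiv G θ0 v}
  have hK : IsCompact K := by
    refine (isCompact_setOf_isFlow_flowEnergy_le _).inter_right ?_
    rw [Set.ofPred_forall]
    exact isClosed_iInter fun v => isClosed_eq (continuous_flowDiv G v) continuous_const
  obtain ⟨θ, ⟨⟨hθ, hle⟩, hdiv⟩, hmin⟩ :=
    hK.exists_isMinOn ⟨θ0, ⟨hθ0, le_rfl⟩, fun _ => rfl⟩ (continuous_flowEnergy G).continuousOn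
  have hmin' (θ' : V → V → ℝ) (hθ' : IsFlow G θ')
      (hdiv' : ∀ v, flowDiv G θ' v = flowDiv G θ0 v) : flowEnergy G θ ≤ flowEnergy G θ' := by
    rcases le_total (flowEnergy G θ') (flowEnergy G θ0) with h | h
    · exact hmin ⟨⟨hθ', h⟩, hdiv'⟩
    · exact hle.trans h
  refine ⟨θ, ⟨hθ, hdiv, hmin'⟩, ?_⟩
  rintro η ⟨hη, hdivη, hminη⟩
  have hmid := hmin' _ (hη.midpoint hθ) fun v => by
    rw [flowDiv_midpoint, hdivη, hdiv, add_self_div_two]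
  rw [flowEnergy_midpoint] at hmid
  have hηθ := hminη θ hθ hdiv
  funext v w
  have hsq := (hη.sub hθ).sq_le_two_mul_flowEnergy v w
  have hzero : (η - θ) v w ^ 2 ≤ 0 := by linarith
  exact sub_eq_zero.1 (pow_eq_zero_iff two_ne_zero |>.1 (le_antisymm hzero (sq_nonneg _)))
end

section
/- Let G be a finite connected simple graph with vertex set V, let F : V → ℝ, and let θ = ∇F be the gradient flow, ∇F(v,w) = F(w) − F(v). Let (z_1,z'_1), …, (z_k,z'_k) be k pairs of vertices, all 2k vertices distinct, with F(z_i) ≥ F(z'_i) for every i, and suppose that for each i there is a simple path γ_i in G from z'_i to z_i of length d_i, such that every edge of G lies on at most D of the paths γ_1, …, γ_k. Then there exist β ∈ ℝ and a flow θ' on G such that div θ'(z_i) = div θ(z_i) + β and div θ'(z'_i) = div θ(z'_i) − β for every i, div θ'(v) = div θ(v) for every vertex v not among the z_i, z'_i, and E(θ') ≤ E(θ) − [Σ_{i=1}^{k} (F(z_i) − F(z'_i))]² / (D²·Σ_{i=1}^{k} d_i). -/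
/-- The gradient flow of a potential `F`. -/
def gradFlow {V : Type*} (F : V → ℝ) : V → V → ℝ := fun v w => F w - F v

/-- The unit flow along the ordered pair `(a, b)`. -/
def unitFlow {V : Type*} [DecidableEq V] (a b v w : V) : ℝ :=
  (if v = a then if w = b then 1 else 0 else 0) - (if v = b then if w = a then 1 else 0 else 0)

/-- The flow sending one unit along each step of a walk. -/
def walkFlow {V : Type*} [DecidableEq V] {G : SimpleGraph V} :
    {a b : V} → G.Walk a b → V → V → ℝ
  | _, _, .nil => fun _ _ => 0
  | a, _, .cons (v := c) _ p => fun v w => unitFlow a c v w + walkFlow p v w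

section General

variable {V : Type*} {G : SimpleGraph V}

lemma IsFlow.sum {ι : Type*} {s : Finset ι} {φ : ι → V → V → ℝ}
    (h : ∀ i ∈ s, IsFlow G (φ i)) : IsFlow G (fun v w => ∑ i ∈ s, φ i v w) := by
  refine ⟨fun v w => ?_, fun v w hvw => Finset.sum_eq_zero fun i hi => (h i hi).2 v w hvw⟩
  rw [← Finset.sum_neg_distrib]
  exact Finset.sum_congr rfl fun i hi => (h i hi).1 v w

lemma sum_neighborFinset_eq [Fintype V] [DecidableRel G.Adj] {f : V → ℝ} {v : V} (hf : ∀ w, ¬ G.Adj v w → f w = 0) :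
    ∑ w ∈ G.neighborFinset v, f w = ∑ w, f w :=
  Finset.sum_subset (Finset.subset_univ _) fun w _ hw => hf w (by simpa using hw)

/-- Perturbing `θ` by a multiple of a flow `φ`, discarding the values of `θ` off the edges. -/
lemma isFlow_restrict_add_mul [DecidableRel G.Adj] {θ φ : V → V → ℝ}
    (hθ : ∀ v w, θ w v = -θ v w) (hφ : IsFlow G φ) (β : ℝ) :
    IsFlow G (fun v w => (if G.Adj v w then θ v w else 0) + β * φ v w) := by
  refine ⟨fun v w => ?_, fun v w hvw => by simp [hvw, hφ.2 v w hvw]⟩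
  simp only [G.adj_comm w v, hφ.1 v w, hθ v w]
  split_ifs <;> ring

variable [DecidableEq V]

lemma isFlow_unitFlow {a b : V} (h : G.Adj a b) : IsFlow G (unitFlow a b) := by
  refine ⟨fun v w => ?_, fun v w hvw => ?_⟩
  · unfold unitFlow
    split_ifs <;> simp
  · have h1 : ¬ (v = a ∧ w = b) := by
      rintro ⟨rfl, rfl⟩
      exact hvw h
    have h2 : ¬ (v = b ∧ w = a) := by
      rintro ⟨rfl, rfl⟩
      exact hvw h.symm
    simp only [unitFlow, ← ite_and, if_neg h1, if_neg h2, sub_zero]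

lemma isFlow_walkFlow {a b : V} (p : G.Walk a b) : IsFlow G (walkFlow p) := by
  induction p with
  | nil => exact ⟨fun _ _ => by simp [walkFlow], fun _ _ _ => rfl⟩
  | cons h p ih =>
    have hu := isFlow_unitFlow h
    refine ⟨fun v w => ?_, fun v w hvw => ?_⟩
    · simp only [walkFlow]
      rw [ih.1 v w, hu.1 v w]
      ring
    · simp only [walkFlow]
      rw [ih.2 v w hvw, hu.2 v w hvw, add_zero]

lemma abs_unitFlow_le {a b : V} (h : a ≠ b) (v w : V) :
    |unitFlow a b v w| ≤ if s(v, w) = s(a, b) then 1 else 0 := by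
  have hs : s(v, w) = s(a, b) ↔ (v = a ∧ w = b) ∨ (v = b ∧ w = a) := by simp
  simp only [unitFlow, hs, ← ite_and]
  split_ifs <;> simp_all

lemma abs_walkFlow_le_count {a b : V} (p : G.Walk a b) (v w : V) :
    |walkFlow p v w| ≤ (p.edges.count s(v, w) : ℝ) := by
  induction p with
  | nil => simp [walkFlow]
  | @cons a c b h p ih =>
    have hu := abs_unitFlow_le h.ne v w
    have hc : ((SimpleGraph.Walk.cons h p).edges.count s(v, w) : ℝ)
        = p.edges.count s(v, w) + if s(v, w) = s(a, c) then 1 else 0 := by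
      rw [SimpleGraph.Walk.edges_cons, List.count_cons]
      simp only [beq_iff_eq, eq_comm (a := s(a, c))]
      push_cast
      rfl
    rw [hc]
    exact (abs_add_le _ _).trans (by linarith)

lemma SimpleGraph.Walk.IsTrail.abs_walkFlow_le {a b : V} {p : G.Walk a b} (hp : p.IsTrail)
    (v w : V) : |walkFlow p v w| ≤ if s(v, w) ∈ p.edges then 1 else 0 := by
  refine (abs_walkFlow_le_count p v w).trans ?_
  split_ifs with h
  · exact_mod_cast List.nodup_iff_count_le_one.1 hp.edges_nodup _
  · simp [List.count_eq_zero_of_not_mem h]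

variable [Fintype V]

lemma sum_unitFlow (a b v : V) :
    ∑ w, unitFlow a b w v = (if v = b then 1 else 0) - (if v = a then 1 else 0) := by
  simp [unitFlow, Finset.sum_sub_distrib]

lemma sum_walkFlow {a b : V} (p : G.Walk a b) (v : V) :
    ∑ w, walkFlow p w v = (if v = b then 1 else 0) - (if v = a then 1 else 0) := by
  induction p with
  | nil => simp [walkFlow]
  | cons h p ih =>
    simp only [walkFlow, Finset.sum_add_distrib, ih, sum_unitFlow]
    ring

lemma sum_gradFlow_mul_unitFlow (F : V → ℝ) (a b : V) :
    ∑ v, ∑ w, gradFlow F v w * unitFlow a b v w = 2 * (F b - F a) := by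
  have h (v : V) : ∑ w, gradFlow F v w * unitFlow a b v w
      = (if v = a then F b - F v else 0) - (if v = b then F a - F v else 0) := by
    simp only [unitFlow, mul_sub, Finset.sum_sub_distrib, gradFlow]
    split_ifs <;> simp
  simp only [h, Finset.sum_sub_distrib, Finset.sum_ite_eq', Finset.mem_univ, if_true]
  ring

lemma sum_gradFlow_mul_walkFlow (F : V → ℝ) {a b : V} (p : G.Walk a b) :
    ∑ v, ∑ w, gradFlow F v w * walkFlow p v w = 2 * (F b - F a) := by
  induction p with
  | nil => simp [walkFlow]
  | cons h p ih =>
    simp only [walkFlow, mul_add, Finset.sum_add_distrib, ih, sum_gradFlow_mul_unitFlow]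
    ring

lemma sum_abs_unitFlow_le (a b : V) : ∑ v, ∑ w, |unitFlow a b v w| ≤ 2 := by
  have h (v w : V) : |unitFlow a b v w| ≤
      (if v = a then if w = b then 1 else 0 else 0) +
        (if v = b then if w = a then 1 else 0 else 0) := by
    unfold unitFlow
    split_ifs <;> norm_num
  refine (Finset.sum_le_sum fun v _ => Finset.sum_le_sum fun w _ => h v w).trans_eq ?_
  have h' (c d v : V) : (∑ w, if v = c then if w = d then (1 : ℝ) else 0 else 0)
      = if v = c then 1 else 0 := by
    split_ifs <;> simp
  simp only [Finset.sum_add_distrib, h']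
  norm_num

lemma sum_abs_walkFlow_le {a b : V} (p : G.Walk a b) :
    ∑ v, ∑ w, |walkFlow p v w| ≤ 2 * p.length := by
  induction p with
  | nil => simp [walkFlow]
  | @cons a c b h p ih =>
    simp only [walkFlow, SimpleGraph.Walk.length_cons]
    calc ∑ v, ∑ w, |unitFlow a c v w + walkFlow p v w|
        ≤ ∑ v, ∑ w, (|unitFlow a c v w| + |walkFlow p v w|) :=
          Finset.sum_le_sum fun v _ => Finset.sum_le_sum fun w _ => abs_add_le _ _
      _ ≤ 2 * ((p.length + 1 : ℕ) : ℝ) := by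
          simp only [Finset.sum_add_distrib]
          push_cast
          linarith [sum_abs_unitFlow_le a c]

variable [DecidableRel G.Adj]

lemma IsFlow.flowDiv_eq {φ : V → V → ℝ} (hφ : IsFlow G φ) (v : V) :
    flowDiv G φ v = ∑ w, φ w v :=
  sum_neighborFinset_eq fun w hw => hφ.2 w v fun h => hw h.symm

lemma IsFlow.flowEnergy_eq {φ : V → V → ℝ} (hφ : IsFlow G φ) :
    flowEnergy G φ = 1 / 2 * ∑ v, ∑ w, φ v w ^ 2 := by
  unfold flowEnergy
  congr 1
  exact Finset.sum_congr rfl fun v _ => sum_neighborFinset_eq fun w hw => by simp [hφ.2 v w hw]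

lemma flowDiv_restrict_add_mul (θ φ : V → V → ℝ) (β : ℝ) (v : V) :
    flowDiv G (fun v w => (if G.Adj v w then θ v w else 0) + β * φ v w) v
      = flowDiv G θ v + β * flowDiv G φ v := by
  simp only [flowDiv, Finset.mul_sum, ← Finset.sum_add_distrib]
  refine Finset.sum_congr rfl fun w hw => ?_
  have h : G.Adj w v := ((G.mem_neighborFinset v w).1 hw).symm
  simp [h]

lemma flowEnergy_restrict_add_mul (θ : V → V → ℝ) {φ : V → V → ℝ} (hφ : IsFlow G φ) (β : ℝ) :
    flowEnergy G (fun v w => (if G.Adj v w then θ v w else 0) + β * φ v w)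
      = flowEnergy G θ + β * ∑ v, ∑ w, θ v w * φ v w + β ^ 2 * flowEnergy G φ := by
  have h : ∑ v, ∑ w, θ v w * φ v w = ∑ v, ∑ w ∈ G.neighborFinset v, θ v w * φ v w :=
    Finset.sum_congr rfl fun v _ => (sum_neighborFinset_eq fun w hw => by
      simp [hφ.2 v w hw]).symm
  rw [h]
  simp only [flowEnergy, Finset.mul_sum, ← Finset.sum_add_distrib]
  refine Finset.sum_congr rfl fun v _ => Finset.sum_congr rfl fun w hw => ?_
  have h : G.Adj v w := (G.mem_neighborFinset v w).1 hw
  simp only [h, if_true]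
  ring

/-- Unit flows along trails with edge congestion at most `D` add up to a flow of energy at most
`D` times the total length of the trails. -/
lemma flowEnergy_sum_walkFlow_le {ι : Type*} [Fintype ι] {a b : ι → V}
    (γ : ∀ i, G.Walk (a i) (b i)) (hγ : ∀ i, (γ i).IsTrail) {D : ℕ}
    (hD : ∀ e : Sym2 V, (Finset.univ.filter (fun i => e ∈ (γ i).edges)).card ≤ D) :
    flowEnergy G (fun v w => ∑ i, walkFlow (γ i) v w) ≤ D * ∑ i, ((γ i).length : ℝ) := by
  rw [(IsFlow.sum fun i _ => isFlow_walkFlow (γ i)).flowEnergy_eq]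
  have hsq (v w : V) :
      (∑ i, walkFlow (γ i) v w) ^ 2 ≤ D * ∑ i, |walkFlow (γ i) v w| := by
    have h1 : |∑ i, walkFlow (γ i) v w| ≤ ∑ i, |walkFlow (γ i) v w| :=
      Finset.abs_sum_le_sum_abs _ _
    have h2 : ∑ i, |walkFlow (γ i) v w| ≤ D :=
      calc ∑ i, |walkFlow (γ i) v w|
          ≤ ∑ i, if s(v, w) ∈ (γ i).edges then (1 : ℝ) else 0 :=
            Finset.sum_le_sum fun i _ => (hγ i).abs_walkFlow_le v w
        _ ≤ D := by
            rw [Finset.sum_boole]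
            exact_mod_cast hD s(v, w)
    rw [← sq_abs, sq]
    exact mul_le_mul (h1.trans h2) h1 (abs_nonneg _) (Nat.cast_nonneg _)
  have hswap : ∑ v, ∑ w, ∑ i, |walkFlow (γ i) v w| = ∑ i, ∑ v, ∑ w, |walkFlow (γ i) v w| := by
    rw [Finset.sum_comm]
    simp only [Finset.sum_comm (s := (Finset.univ : Finset V)) (t := (Finset.univ : Finset ι))]
    refine Finset.sum_congr rfl fun i _ => Finset.sum_comm
  calc 1 / 2 * ∑ v, ∑ w, (∑ i, walkFlow (γ i) v w) ^ 2
      ≤ 1 / 2 * ∑ v, ∑ w, (D * ∑ i, |walkFlow (γ i) v w|) := by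
        gcongr with v _ w _
        exact hsq v w
    _ = 1 / 2 * (D * ∑ i, ∑ v, ∑ w, |walkFlow (γ i) v w|) := by
        simp only [← Finset.mul_sum, hswap]
    _ ≤ 1 / 2 * (D * ∑ i, (2 * ((γ i).length : ℝ))) := by
        gcongr with i _
        exact sum_abs_walkFlow_le (γ i)
    _ = D * ∑ i, ((γ i).length : ℝ) := by
        rw [← Finset.mul_sum]
        ring

end General

theorem energy_drop_by_gluing
    {V : Type*} [Fintype V] [DecidableEq V]
    (G : SimpleGraph V) [DecidableRel G.Adj] (hconn : G.Connected)
    (F : V → ℝ) (k : ℕ) (z z' : Fin k → V)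
    (hdistinct : Function.Injective (Sum.elim z z' : Fin k ⊕ Fin k → V))
    (hF : ∀ i, F (z' i) ≤ F (z i))
    (d : Fin k → ℕ) (D : ℕ) (hD : 0 < D)
    (γ : ∀ i : Fin k, G.Walk (z' i) (z i))
    (hγpath : ∀ i, (γ i).IsPath)
    (hγlen : ∀ i, (γ i).length = d i)
    (hoverlap : ∀ e : Sym2 V,
      (Finset.univ.filter (fun i : Fin k => e ∈ (γ i).edges)).card ≤ D) :
    ∃ β : ℝ, ∃ θ' : V → V → ℝ, IsFlow G θ' ∧
      (∀ i, flowDiv G θ' (z i) = flowDiv G (gradFlow F) (z i) + β) ∧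
      (∀ i, flowDiv G θ' (z' i) = flowDiv G (gradFlow F) (z' i) - β) ∧
      (∀ v : V, (∀ i, v ≠ z i ∧ v ≠ z' i) →
        flowDiv G θ' v = flowDiv G (gradFlow F) v) ∧
      flowEnergy G θ' ≤ flowEnergy G (gradFlow F)
        - (∑ i : Fin k, (F (z i) - F (z' i))) ^ 2
          / ((D : ℝ) ^ 2 * ∑ i : Fin k, (d i : ℝ)) := by
  set φ : V → V → ℝ := fun v w => ∑ i, walkFlow (γ i) v w with hφ_def
  have hφ : IsFlow G φ := IsFlow.sum fun i _ => isFlow_walkFlow (γ i)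
  have hdiv (v : V) :
      flowDiv G φ v = ∑ i, ((if v = z i then (1 : ℝ) else 0) - if v = z' i then 1 else 0) := by
    rw [hφ.flowDiv_eq, Finset.sum_comm]
    exact Finset.sum_congr rfl fun i _ => sum_walkFlow (γ i) v
  have hz : Function.Injective z := hdistinct.comp Sum.inl_injective
  have hz' : Function.Injective z' := hdistinct.comp Sum.inr_injective
  have hne (i j : Fin k) : z i ≠ z' j := fun h =>
    Sum.inl_ne_inr (hdistinct (a₁ := Sum.inl i) (a₂ := Sum.inr j) h)
  set S : ℝ := ∑ i, (F (z i) - F (z' i)) with hS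
  have hinner : ∑ v, ∑ w, gradFlow F v w * φ v w = 2 * S := by
    have h : ∑ v, ∑ w, gradFlow F v w * φ v w
        = ∑ i, ∑ v, ∑ w, gradFlow F v w * walkFlow (γ i) v w := by
      rw [Finset.sum_comm]
      simp only [hφ_def, Finset.mul_sum]
      simp only [Finset.sum_comm (s := (Finset.univ : Finset V))
        (t := (Finset.univ : Finset (Fin k)))]
      exact Finset.sum_congr rfl fun i _ => Finset.sum_comm
    rw [h, hS, Finset.mul_sum]
    exact Finset.sum_congr rfl fun i _ => sum_gradFlow_mul_walkFlow F (γ i)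
  set M : ℝ := (D : ℝ) ^ 2 * ∑ i, (d i : ℝ) with hM
  have hL : 0 ≤ ∑ i, (d i : ℝ) := Finset.sum_nonneg fun i _ => Nat.cast_nonneg _
  have hEM : flowEnergy G φ ≤ M := by
    have h := flowEnergy_sum_walkFlow_le γ (fun i => (hγpath i).isTrail) hoverlap
    simp only [hγlen] at h
    refine h.trans (mul_le_mul_of_nonneg_right ?_ hL)
    have hD1 : (1 : ℝ) ≤ D := by exact_mod_cast hD
    nlinarith
  refine ⟨-(S / M), fun v w => (if G.Adj v w then gradFlow F v w else 0) + -(S / M) * φ v w,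
    isFlow_restrict_add_mul (fun v w => by simp [gradFlow]) hφ _, fun i => ?_, fun i => ?_,
    fun v hv => ?_, ?_⟩
  · rw [flowDiv_restrict_add_mul, hdiv]
    simp [hne, hz.eq_iff]
  · rw [flowDiv_restrict_add_mul, hdiv]
    simp [(hne _ _).symm, hz'.eq_iff]
  · rw [flowDiv_restrict_add_mul, hdiv]
    simp [fun i => (hv i).1, fun i => (hv i).2]
  · rw [flowEnergy_restrict_add_mul _ hφ, hinner]
    have h1 := mul_le_mul_of_nonneg_left hEM (sq_nonneg (S / M))
    have h2 : (S / M) ^ 2 * M = S ^ 2 / M := by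
      by_cases h0 : M = 0
      · simp [h0]
      · field_simp
    have h3 : S / M * (2 * S) = 2 * (S ^ 2 / M) := by ring
    rw [neg_sq, neg_mul, h3]
    linarith
end
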